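/- For every integer ℓ ≥ 2 and all real numbers α ∈ (0,1] and μ ∈ (0,1] there exists δ > 0 (depending only on α, ℓ, μ) with the following property: for every finite set Ω, every ℓ-step probability distribution P on Ω^ℓ with equal marginals that is generated by Markov chains and satisfies α(P) ≥ α, every n ≥ 1, and every function f : Ωⁿ → [0,1] with E[f(X^{(1)})] = μ, one has E[∏_{j=1}^ℓ f(X^{(j)})] ≥ δ. -/

import Mathlib

namespace SameSetHitting

/-- `P` is a probability distribution on a finite type. -/
def IsDist {α : Type} [Fintype α] (P : α → ℝ) : Prop :=
  (∀ x, 0 ≤ P x) ∧ ∑ x, P x = 1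

open Classical in
/-- The `j`-th marginal of an `ℓ`-step distribution `P`. -/
noncomputable def marginal {Ω : Type} [Fintype Ω] {ℓ : ℕ}
    (P : (Fin ℓ → Ω) → ℝ) (j : Fin ℓ) (a : Ω) : ℝ :=
  ∑ x : Fin ℓ → Ω, if x j = a then P x else 0

/-- All `ℓ` marginals of `P` are equal to `π`. -/
def HasMarginals {Ω : Type} [Fintype Ω] {ℓ : ℕ}
    (P : (Fin ℓ → Ω) → ℝ) (π : Ω → ℝ) : Prop :=
  ∀ j a, marginal P j a = π a

/-- The expectation `E[f(X)]` where `X` has the product law `πⁿ`. -/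
noncomputable def exps {Ω : Type} [Fintype Ω] {n : ℕ}
    (π : Ω → ℝ) (f : (Fin n → Ω) → ℝ) : ℝ :=
  ∑ v : Fin n → Ω, (∏ i, π (v i)) * f v

/-- `E[∏_{j} f_j(X^{(j)})]` where the tuples `(X_i^{(1)}, …, X_i^{(ℓ)})`,
`i = 1, …, n`, are i.i.d. with law `P` and `X^{(j)} = (X_1^{(j)}, …, X_n^{(j)})`. -/
noncomputable def prodExp {Ω : Type} [Fintype Ω] {ℓ n : ℕ}
    (P : (Fin ℓ → Ω) → ℝ) (f : Fin ℓ → ((Fin n → Ω) → ℝ)) : ℝ :=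
  ∑ x : Fin ℓ → Fin n → Ω, (∏ i, P (fun j => x j i)) * ∏ j, f j (x j)

/-- Expectation under the single-coordinate multi-step distribution `P`. -/
noncomputable def expP {Ω : Type} [Fintype Ω] {ℓ : ℕ}
    (P : (Fin ℓ → Ω) → ℝ) (f : (Fin ℓ → Ω) → ℝ) : ℝ :=
  ∑ x, P x * f x

/-- Covariance under `P`. -/
noncomputable def covP {Ω : Type} [Fintype Ω] {ℓ : ℕ}
    (P : (Fin ℓ → Ω) → ℝ) (f g : (Fin ℓ → Ω) → ℝ) : ℝ :=
  expP P (fun x => f x * g x) - expP P f * expP P g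

/-- Variance under `P`. -/
noncomputable def varP {Ω : Type} [Fintype Ω] {ℓ : ℕ}
    (P : (Fin ℓ → Ω) → ℝ) (f : (Fin ℓ → Ω) → ℝ) : ℝ :=
  covP P f f

/-- `f` depends only on the coordinates in `S`. -/
def DependsOn {Ω : Type} {ℓ : ℕ} (f : (Fin ℓ → Ω) → ℝ) (S : Finset (Fin ℓ)) : Prop :=
  ∀ x y : Fin ℓ → Ω, (∀ j ∈ S, x j = y j) → f x = f y

/-- The correlation `ρ(P, S, T)`. -/
noncomputable def rhoST {Ω : Type} [Fintype Ω] {ℓ : ℕ}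
    (P : (Fin ℓ → Ω) → ℝ) (S T : Finset (Fin ℓ)) : ℝ :=
  sSup {r : ℝ | ∃ f g : (Fin ℓ → Ω) → ℝ, DependsOn f S ∧ DependsOn g T ∧
    varP P f = 1 ∧ varP P g = 1 ∧ r = covP P f g}

/-- The correlation `ρ(P) = max_j ρ(P, {j}, [ℓ]∖{j})`. -/
noncomputable def rho {Ω : Type} [Fintype Ω] {ℓ : ℕ} (P : (Fin ℓ → Ω) → ℝ) : ℝ :=
  ⨆ j : Fin ℓ, rhoST P {j} ({j}ᶜ)

/-- Expectation under the single-step distribution `π`. -/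
noncomputable def expPi {Ω : Type} [Fintype Ω] (π : Ω → ℝ) (f : Ω → ℝ) : ℝ :=
  ∑ a, π a * f a

/-- Variance under the single-step distribution `π`. -/
noncomputable def varPi {Ω : Type} [Fintype Ω] (π : Ω → ℝ) (f : Ω → ℝ) : ℝ :=
  expPi π (fun a => (f a - expPi π f) ^ 2)

/-- The influence `Inf_i(f(X))` of coordinate `i`, where `X` has product law `πⁿ`. -/
noncomputable def influence {Ω : Type} [Fintype Ω] {n : ℕ}
    (π : Ω → ℝ) (i : Fin n) (f : (Fin n → Ω) → ℝ) : ℝ :=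
  ∑ v : Fin n → Ω, (∏ k, π (v k)) * varPi π (fun a => f (Function.update v i a))

/-- The function obtained from `f` by applying the restriction `R`
(`none` means unrestricted). -/
def restrict {Ω : Type} {n : ℕ} (R : Fin n → Option Ω)
    (f : (Fin n → Ω) → ℝ) : (Fin n → Ω) → ℝ :=
  fun x => f (fun i => (R i).getD (x i))

/-- The size (number of restricted coordinates) of a restriction. -/
def restSize {Ω : Type} {n : ℕ} (R : Fin n → Option Ω) : ℕ :=
  (Finset.univ.filter (fun i => (R i).isSome = true)).card

/-- `f` is `ε`-resilient up to size `k` (with respect to the product law `πⁿ`). -/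
def Resilient {Ω : Type} [Fintype Ω] {n : ℕ} (π : Ω → ℝ) (ε : ℝ) (k : ℕ)
    (f : (Fin n → Ω) → ℝ) : Prop :=
  ∀ R : Fin n → Option Ω, restSize R ≤ k →
    (1 - ε) * exps π f ≤ exps π (restrict R f) ∧
    exps π (restrict R f) ≤ (1 + ε) * exps π f

/-- The restriction operator `R[i,a]`. -/
def restrOp {Ω : Type} {n : ℕ} (i : Fin n) (a : Ω)
    (f : (Fin n → Ω) → ℝ) : (Fin n → Ω) → ℝ :=
  fun x => f (Function.update x i a)

/-- The maximum operator `M[i,y,z]`. -/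
def maxOp {Ω : Type} {n : ℕ} (i : Fin n) (y z : Ω)
    (f : (Fin n → Ω) → ℝ) : (Fin n → Ω) → ℝ :=
  fun x => max (f (Function.update x i y)) (f (Function.update x i z))

/-- Insert the value `a` at position `j` into `w : Ω^{[ℓ] ∖ {j}}`. -/
def ins {Ω : Type} {ℓ : ℕ} (j : Fin ℓ) (w : {k : Fin ℓ // k ≠ j} → Ω) (a : Ω) :
    Fin ℓ → Ω :=
  fun k => if h : k = j then a else w ⟨k, h⟩

/-- The probability that the coordinates other than `j` equal `w`. -/
noncomputable def margOff {Ω : Type} [Fintype Ω] {ℓ : ℕ}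
    (P : (Fin ℓ → Ω) → ℝ) (j : Fin ℓ) (w : {k : Fin ℓ // k ≠ j} → Ω) : ℝ :=
  ∑ a, P (ins j w a)

open Classical in
/-- The joint law of `(Y, Z)` for a double sample on step `j` from `P`. -/
noncomputable def doubleSample {Ω : Type} [Fintype Ω] {ℓ : ℕ}
    (P : (Fin ℓ → Ω) → ℝ) (j : Fin ℓ) (y z : Ω) : ℝ :=
  ∑ w : {k : Fin ℓ // k ≠ j} → Ω,
    if margOff P j w = 0 then 0
    else P (ins j w y) * P (ins j w z) / margOff P j w


open Classical in
/-- The probability of the event `E` under `P`. -/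
noncomputable def pr {Ω : Type} [Fintype Ω] {ℓ : ℕ}
    (P : (Fin ℓ → Ω) → ℝ) (E : (Fin ℓ → Ω) → Prop) : ℝ :=
  ∑ y : Fin ℓ → Ω, if E y then P y else 0

/-- `P` is generated by Markov chains: for every step `j ≥ 2` (0-indexed:
`j ≥ 1`), conditioned on the whole past, `X^{(j)}` only depends on `X^{(j-1)}`. -/
def MarkovGenerated {Ω : Type} [Fintype Ω] {ℓ : ℕ}
    (P : (Fin ℓ → Ω) → ℝ) : Prop :=
  ∀ j : Fin ℓ, 0 < (j : ℕ) → ∀ x : Fin ℓ → Ω,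
    0 < pr P (fun y => ∀ k : Fin ℓ, (k : ℕ) < (j : ℕ) → y k = x k) →
    pr P (fun y => ∀ k : Fin ℓ, (k : ℕ) ≤ (j : ℕ) → y k = x k) /
        pr P (fun y => ∀ k : Fin ℓ, (k : ℕ) < (j : ℕ) → y k = x k) =
      pr P (fun y => y j = x j ∧ ∀ k : Fin ℓ, (k : ℕ) + 1 = (j : ℕ) → y k = x k) /
        pr P (fun y => ∀ k : Fin ℓ, (k : ℕ) + 1 = (j : ℕ) → y k = x k)



/-! ### Weighted sums over product spaces -/

/-- Weighted sum over a product space, with coordinate dependent weights. -/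
noncomputable def wE {α : Type} [Fintype α] {n : ℕ} (w : Fin n → α → ℝ)
    (f : (Fin n → α) → ℝ) : ℝ :=
  ∑ x : Fin n → α, (∏ i, w i (x i)) * f x

section wE
variable {α : Type} [Fintype α] {n : ℕ}

lemma wE_add (w : Fin n → α → ℝ) (f g : (Fin n → α) → ℝ) :
    wE w (fun x => f x + g x) = wE w f + wE w g := by
  simp [wE, mul_add, Finset.sum_add_distrib]

lemma wE_sub (w : Fin n → α → ℝ) (f g : (Fin n → α) → ℝ) :
    wE w (fun x => f x - g x) = wE w f - wE w g := by
  simp [wE, mul_sub, Finset.sum_sub_distrib]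

lemma wE_smul (w : Fin n → α → ℝ) (c : ℝ) (f : (Fin n → α) → ℝ) :
    wE w (fun x => c * f x) = c * wE w f := by
  simp only [wE, Finset.mul_sum]
  exact Finset.sum_congr rfl fun x _ => by ring

lemma wE_sum {β : Type} (s : Finset β) (w : Fin n → α → ℝ) (f : β → (Fin n → α) → ℝ) :
    wE w (fun x => ∑ b ∈ s, f b x) = ∑ b ∈ s, wE w (f b) := by
  simp only [wE, Finset.mul_sum]
  rw [Finset.sum_comm]

lemma wE_mono (w : Fin n → α → ℝ) (hw : ∀ i a, 0 ≤ w i a) {f g : (Fin n → α) → ℝ}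
    (h : ∀ x, f x ≤ g x) : wE w f ≤ wE w g :=
  Finset.sum_le_sum fun x _ =>
    mul_le_mul_of_nonneg_left (h x) (Finset.prod_nonneg fun i _ => hw i _)

lemma wE_const (w : Fin n → α → ℝ) (hw : ∀ i, ∑ a, w i a = 1) (c : ℝ) :
    wE w (fun _ => c) = c := by
  have : ∑ x : Fin n → α, ∏ i, w i (x i) = 1 := by
    rw [← Fintype.prod_sum]; simp [hw]
  simp [wE, ← Finset.sum_mul, this]

lemma wE_nonneg (w : Fin n → α → ℝ) (hw : ∀ i a, 0 ≤ w i a) {f : (Fin n → α) → ℝ}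
    (h : ∀ x, 0 ≤ f x) : 0 ≤ wE w f :=
  Finset.sum_nonneg fun x _ => mul_nonneg (Finset.prod_nonneg fun i _ => hw i _) (h x)

lemma wE_abs_le (w : Fin n → α → ℝ) (hw : ∀ i a, 0 ≤ w i a) (f : (Fin n → α) → ℝ) :
    |wE w f| ≤ wE w (fun x => |f x|) := by
  refine (Finset.abs_sum_le_sum_abs _ _).trans (le_of_eq ?_)
  refine Finset.sum_congr rfl fun x _ => ?_
  rw [abs_mul, abs_of_nonneg (Finset.prod_nonneg fun i _ => hw i _)]

lemma wE_update (w : Fin n → α → ℝ) (i : Fin n) (v : α → ℝ) (hw : ∑ a, w i a = 1)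
    (f : (Fin n → α) → ℝ) :
    wE (Function.update w i v) f
      = ∑ a, v a * wE w (fun x => f (Function.update x i a)) := by
  have key : ∑ p : α × (Fin n → α), v p.1 * ((∏ j, w j (p.2 j)) * f (Function.update p.2 i p.1))
      = ∑ p : α × (Fin n → α), w i p.1 * ((∏ j, (Function.update w i v) j (p.2 j)) * f p.2) := by
    refine Finset.sum_nbij' (fun p => (p.2 i, Function.update p.2 i p.1))
      (fun p => (p.2 i, Function.update p.2 i p.1)) (by simp) (by simp) ?_ ?_ ?_
    · rintro ⟨a, x⟩ _; simp
    · rintro ⟨a, x⟩ _; simp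
    · rintro ⟨a, x⟩ _
      simp only
      rw [← Finset.mul_prod_erase Finset.univ _ (Finset.mem_univ i),
        ← Finset.mul_prod_erase Finset.univ (fun j => Function.update w i v j _) (Finset.mem_univ i)]
      have : ∏ j ∈ Finset.univ.erase i, Function.update w i v j (Function.update x i a j)
          = ∏ j ∈ Finset.univ.erase i, w j (x j) := by
        refine Finset.prod_congr rfl fun j hj => ?_
        have := Finset.ne_of_mem_erase hj
        simp [this]
      rw [this]
      simp
      ring
  rw [Fintype.sum_prod_type, Fintype.sum_prod_type] at key
  simp only [wE, Finset.mul_sum]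
  rw [key, Finset.sum_comm]
  refine Finset.sum_congr rfl fun x _ => ?_
  simp only
  rw [← Finset.sum_mul, hw, one_mul]

lemma wE_resample (w : Fin n → α → ℝ) (i : Fin n) (hw : ∑ a, w i a = 1)
    (f : (Fin n → α) → ℝ) :
    wE w f = ∑ a, w i a * wE w (fun x => f (Function.update x i a)) := by
  have := wE_update w i (w i) hw f
  rwa [Function.update_eq_self] at this

/-- resampling, inside form -/
lemma wE_resample' (w : Fin n → α → ℝ) (i : Fin n) (hw : ∑ a, w i a = 1)
    (f : (Fin n → α) → ℝ) :
    wE w f = wE w (fun x => ∑ a, w i a * f (Function.update x i a)) := by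
  rw [wE_resample w i hw, wE_sum]
  exact Finset.sum_congr rfl fun a _ => (wE_smul _ _ _).symm

end wE


/-! ### Kernels -/

/-- A probability kernel `k` from `B` (law `r`) to `Ω` (law `p`) which contracts
mean-zero functions. -/
structure Ker {Ω B : Type} [Fintype Ω] [Fintype B] (p : Ω → ℝ) (r : B → ℝ)
    (k : B → Ω → ℝ) (ρ : ℝ) : Prop where
  hr : ∀ b, 0 < r b
  hr1 : ∑ b, r b = 1
  hp : ∀ x, 0 ≤ p x
  hp1 : ∑ x, p x = 1
  hk : ∀ b x, 0 ≤ k b x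
  hk1 : ∀ b, ∑ x, k b x = 1
  hpk : ∀ x, ∑ b, r b * k b x = p x
  hρ0 : 0 ≤ ρ
  hρ1 : ρ < 1
  contr : ∀ u : Ω → ℝ, ∑ b, r b * (∑ x, k b x * u x) ^ 2
    ≤ (1 - ρ) * (∑ x, p x * u x) ^ 2 + ρ * ∑ x, p x * u x ^ 2

/-- The tensor power of the kernel `k` acting on functions. -/
noncomputable def Kop {Ω B : Type} [Fintype Ω] (k : B → Ω → ℝ) {n : ℕ}
    (f : (Fin n → Ω) → ℝ) : (Fin n → B) → ℝ :=
  fun b => wE (fun j => k (b j)) f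

/-- Averaging over the `i`-th coordinate. -/
noncomputable def Eop {Ω : Type} [Fintype Ω] (p : Ω → ℝ) {n : ℕ} (i : Fin n)
    (f : (Fin n → Ω) → ℝ) : (Fin n → Ω) → ℝ :=
  fun x => ∑ a, p a * f (Function.update x i a)

/-- Expectation with respect to a product law. -/
noncomputable abbrev pE {Ω : Type} [Fintype Ω] (p : Ω → ℝ) {n : ℕ}
    (f : (Fin n → Ω) → ℝ) : ℝ := wE (fun _ => p) f

lemma Kop_update {Ω B : Type} [Fintype Ω] {k : B → Ω → ℝ}
    (hk1 : ∀ b, ∑ x, k b x = 1) {n : ℕ}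
    (f : (Fin n → Ω) → ℝ) (b : Fin n → B) (i : Fin n) (β : B) :
    Kop k f (Function.update b i β)
      = ∑ a, k β a * Kop k (fun x => f (Function.update x i a)) b := by
  have h := wE_update (fun j => k (b j)) i (k β) (hk1 _) f
  refine Eq.trans ?_ h
  show wE _ f = wE _ f
  congr 1
  funext j
  by_cases hj : j = i
  · subst hj; simp
  · simp [hj]

lemma Kop_self {Ω B : Type} [Fintype Ω] {k : B → Ω → ℝ}
    (hk1 : ∀ b, ∑ x, k b x = 1) {n : ℕ}
    (f : (Fin n → Ω) → ℝ) (b : Fin n → B) (i : Fin n) :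
    Kop k f b = ∑ a, k (b i) a * Kop k (fun x => f (Function.update x i a)) b := by
  rw [← Kop_update hk1, Function.update_eq_self]

/-- weighted Jensen for squares -/
lemma sq_sum_le {α : Type} [Fintype α] (p u : α → ℝ) (hp : ∀ a, 0 ≤ p a)
    (hp1 : ∑ a, p a = 1) : (∑ a, p a * u a) ^ 2 ≤ ∑ a, p a * u a ^ 2 := by
  have h : 0 ≤ ∑ a, p a * (u a - ∑ c, p c * u c) ^ 2 :=
    Finset.sum_nonneg fun a _ => mul_nonneg (hp a) (sq_nonneg _)
  have e : ∑ a, p a * (u a - ∑ c, p c * u c) ^ 2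
      = ∑ a, p a * u a ^ 2 - (∑ a, p a * u a) ^ 2 := by
    set m := ∑ c, p c * u c with hm
    have : ∀ a, p a * (u a - m) ^ 2 = p a * u a ^ 2 - 2 * m * (p a * u a) + m ^ 2 * p a := by
      intro a; ring
    simp only [this, Finset.sum_add_distrib, Finset.sum_sub_distrib, ← Finset.mul_sum, ← hm, hp1]
    ring
  linarith

lemma var_eq {α : Type} [Fintype α] (p u : α → ℝ) 
    (hp1 : ∑ a, p a = 1) : ∑ a, p a * (u a - ∑ c, p c * u c) ^ 2
      = ∑ a, p a * u a ^ 2 - (∑ a, p a * u a) ^ 2 := by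
  set m := ∑ c, p c * u c with hm
  have : ∀ a, p a * (u a - m) ^ 2 = p a * u a ^ 2 - 2 * m * (p a * u a) + m ^ 2 * p a := by
    intro a; ring
  simp only [this, Finset.sum_add_distrib, Finset.sum_sub_distrib, ← Finset.mul_sum, ← hm, hp1]
  ring

section ker
variable {Ω B : Type} [Fintype Ω] [Fintype B] {p : Ω → ℝ} {r : B → ℝ} {k : B → Ω → ℝ} {ρ : ℝ}
  {n : ℕ}

lemma Ker.mean (h : Ker p r k ρ) (u : Ω → ℝ) :
    ∑ b, r b * ∑ x, k b x * u x = ∑ x, p x * u x := by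
  simp only [Finset.mul_sum, ← h.hpk, Finset.sum_mul]
  rw [Finset.sum_comm]
  exact Finset.sum_congr rfl fun x _ => Finset.sum_congr rfl fun b _ => by ring

lemma Kop_sub (f g : (Fin n → Ω) → ℝ) (b : Fin n → B) :
    Kop k (fun x => f x - g x) b = Kop k f b - Kop k g b := wE_sub _ _ _

lemma Kop_Eop (f : (Fin n → Ω) → ℝ) (i : Fin n) (b : Fin n → B) :
    Kop k (Eop p i f) b = ∑ a, p a * Kop k (fun x => f (Function.update x i a)) b := by
  show wE _ (fun x => ∑ a, p a * f (Function.update x i a)) = _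
  rw [wE_sum]
  exact Finset.sum_congr rfl fun a _ => wE_smul _ _ _

lemma Ker.Kop_Eop (h : Ker p r k ρ) (f : (Fin n → Ω) → ℝ) (i : Fin n) (b : Fin n → B) :
    Kop k (Eop p i f) b = ∑ β, r β * Kop k f (Function.update b i β) := by
  rw [SameSetHitting.Kop_Eop]
  simp only [Kop_update h.hk1]
  rw [h.mean]

lemma Ker.Kop_mem (h : Ker p r k ρ) {f : (Fin n → Ω) → ℝ} (hf : ∀ x, f x ∈ Set.Icc (0:ℝ) 1)
    (b : Fin n → B) : Kop k f b ∈ Set.Icc (0:ℝ) 1 := by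
  refine ⟨wE_nonneg _ (fun i a => h.hk _ _) fun x => (hf x).1, ?_⟩
  refine (wE_mono _ (fun i a => h.hk _ _) fun x => (hf x).2).trans (le_of_eq ?_)
  exact wE_const _ (fun i => h.hk1 _) 1

lemma Eop_mem (hp : ∀ x, 0 ≤ p x) (hp1 : ∑ x, p x = 1) {f : (Fin n → Ω) → ℝ}
    (hf : ∀ x, f x ∈ Set.Icc (0:ℝ) 1) (i : Fin n) (x : Fin n → Ω) :
    Eop p i f x ∈ Set.Icc (0:ℝ) 1 := by
  refine ⟨Finset.sum_nonneg fun a _ => mul_nonneg (hp a) (hf _).1, ?_⟩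
  rw [← hp1]
  exact Finset.sum_le_sum fun a _ => mul_le_of_le_one_right (hp a) (hf _).2

lemma Eop_update (f : (Fin n → Ω) → ℝ) (i : Fin n) (x : Fin n → Ω) (a : Ω) :
    Eop p i f (Function.update x i a) = Eop p i f x := by
  simp [Eop]

lemma Eop_comm (f : (Fin n → Ω) → ℝ) (i j : Fin n) :
    Eop p i (Eop p j f) = Eop p j (Eop p i f) := by
  by_cases hij : i = j
  · subst hij; rfl
  funext x
  simp only [Eop, Finset.mul_sum]
  rw [Finset.sum_comm]
  refine Finset.sum_congr rfl fun a _ => Finset.sum_congr rfl fun c _ => ?_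
  rw [Function.update_comm hij]
  ring

lemma Eop_sub (f g : (Fin n → Ω) → ℝ) (i : Fin n) :
    Eop p i (fun x => f x - g x) = fun x => Eop p i f x - Eop p i g x := by
  funext x; simp [Eop, mul_sub, Finset.sum_sub_distrib]

lemma pE_Eop (hp1 : ∑ x, p x = 1) (f : (Fin n → Ω) → ℝ) (i : Fin n) :
    pE p (Eop p i f) = pE p f := by
  exact (wE_resample' (fun _ => p) i hp1 f).symm

/-- Orthogonality. -/
lemma pE_sq_sub (hp1 : ∑ x, p x = 1) (f : (Fin n → Ω) → ℝ) (i : Fin n) :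
    pE p (fun x => (f x - Eop p i f x) ^ 2)
      = pE p (fun x => f x ^ 2) - pE p (fun x => Eop p i f x ^ 2) := by
  rw [← wE_sub]
  refine (wE_resample' (fun _ => p) i hp1 _).trans (Eq.trans ?_
    (wE_resample' (fun _ => p) i hp1 _).symm)
  congr 1
  funext x
  simp only [Eop_update]
  have := var_eq p (fun a => f (Function.update x i a)) hp1
  simp only [mul_sub, Finset.sum_sub_distrib, ← Finset.sum_mul, hp1, one_mul]
  simpa [Eop, mul_sub] using this

/-- The smoothed influence. -/
noncomputable def Infl (p : Ω → ℝ) (r : B → ℝ) (k : B → Ω → ℝ) (i : Fin n)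
    (f : (Fin n → Ω) → ℝ) : ℝ :=
  pE r (fun b => Kop k (fun x => f x - Eop p i f x) b ^ 2)

lemma Infl_nonneg (h : Ker p r k ρ) (i : Fin n) (f : (Fin n → Ω) → ℝ) : 0 ≤ Infl p r k i f :=
  wE_nonneg _ (fun _ b => (h.hr b).le) fun _ => sq_nonneg _

lemma Infl_Eop_le (h : Ker p r k ρ) (i j : Fin n) (f : (Fin n → Ω) → ℝ) :
    Infl p r k i (Eop p j f) ≤ Infl p r k i f := by
  have e : (fun x => Eop p j f x - Eop p i (Eop p j f) x)
      = Eop p j (fun x => f x - Eop p i f x) := by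
    rw [Eop_sub, Eop_comm]
  unfold Infl
  rw [e]
  rw [pE, pE, wE_resample' (fun _ => r) j h.hr1 (fun b => Kop k (fun x => f x - Eop p i f x) b ^ 2)]
  refine wE_mono _ (fun _ b => (h.hr b).le) fun b => ?_
  rw [h.Kop_Eop]
  exact sq_sum_le r _ (fun b => (h.hr b).le) h.hr1

lemma Kop_sq_le (h : Ker p r k ρ) (f : (Fin n → Ω) → ℝ) (b : Fin n → B) :
    Kop k f b ^ 2 ≤ Kop k (fun x => f x ^ 2) b := by
  have h0 : 0 ≤ Kop k (fun x => (f x - Kop k f b) ^ 2) b :=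
    wE_nonneg _ (fun i a => h.hk _ _) fun x => sq_nonneg _
  have e : (fun x => (f x - Kop k f b) ^ 2)
      = fun x => f x ^ 2 + ((- 2 * Kop k f b) * f x + (Kop k f b) ^ 2) := by
    funext x; ring
  rw [e] at h0
  unfold Kop at h0 ⊢
  rw [wE_add, wE_add, wE_smul, wE_const _ (fun i => h.hk1 _)] at h0
  nlinarith

lemma pE_Kop (h : Ker p r k ρ) (f : (Fin n → Ω) → ℝ) : pE r (Kop k f) = pE p f := by
  simp only [wE, Kop, Finset.mul_sum]
  rw [Finset.sum_comm]
  refine Finset.sum_congr rfl fun x _ => ?_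
  simp only [← mul_assoc, ← Finset.sum_mul, ← Finset.prod_mul_distrib]
  congr 1
  rw [← Fintype.prod_sum (fun i b => r b * k b (x i))]
  exact Finset.prod_congr rfl fun i _ => h.hpk _

lemma pE_Kop_sq_le (h : Ker p r k ρ) (f : (Fin n → Ω) → ℝ) :
    pE r (fun b => Kop k f b ^ 2) ≤ pE p (fun x => f x ^ 2) := by
  rw [← pE_Kop h]
  exact wE_mono _ (fun _ b => (h.hr b).le) (Kop_sq_le h f)

/-- Energy increment. -/
lemma gap (h : Ker p r k ρ) (i : Fin n) (f : (Fin n → Ω) → ℝ) :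
    pE r (fun b => Kop k f b ^ 2) + (1 - ρ) * Infl p r k i f
      ≤ ∑ a, p a * pE r (fun b => Kop k (fun x => f (Function.update x i a)) b ^ 2) := by
  unfold Infl
  have hr : ∀ (_ : Fin n) b, 0 ≤ r b := fun _ b => (h.hr b).le
  have e : ∑ a, p a * pE r (fun b => Kop k (fun x => f (Function.update x i a)) b ^ 2)
      = pE r (fun b => ∑ a, p a * Kop k (fun x => f (Function.update x i a)) b ^ 2) := by
    rw [pE, wE_sum]
    exact Finset.sum_congr rfl fun a _ => (wE_smul _ _ _).symm
  rw [e, ← wE_smul, ← wE_add, wE_resample' (fun _ => r) i h.hr1]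
  refine wE_mono _ hr fun b => ?_
  simp only [Kop_sub, h.Kop_Eop, Function.update_idem]
  set m := ∑ β, r β * Kop k f (Function.update b i β) with hm
  set u : Ω → ℝ := fun a => Kop k (fun x => f (Function.update x i a)) b with hu
  have hu' : ∀ β, Kop k f (Function.update b i β) = ∑ a, k β a * u a := fun β =>
    Kop_update h.hk1 f b i β
  have hm2 : m = ∑ a, p a * u a := by
    rw [hm]; simp only [hu']; exact h.mean u
  have hv := var_eq r (fun β => Kop k f (Function.update b i β)) h.hr1
  rw [← hm] at hv
  have hc := h.contr u
  simp only [← hu', ← hm2] at hc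
  have e2 : ∑ a, r a * (Kop k f (Function.update b i a) ^ 2
      + (1 - ρ) * (Kop k f (Function.update b i a) - m) ^ 2)
      = ∑ a, r a * Kop k f (Function.update b i a) ^ 2
      + (1 - ρ) * ∑ a, r a * (Kop k f (Function.update b i a) - m) ^ 2 := by
    rw [Finset.mul_sum, ← Finset.sum_add_distrib]
    exact Finset.sum_congr rfl fun a _ => by ring
  rw [e2, hv]
  have h1 := sq_sum_le p u h.hp h.hp1
  rw [← hm2] at h1
  have := h.hρ1; have := h.hρ0
  have hu2 : ∑ a, p a * Kop k (fun x => f (Function.update x i a)) b ^ 2 = ∑ a, p a * u a ^ 2 := rfl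
  rw [hu2]
  generalize (∑ a, p a * u a ^ 2) = V at *
  generalize (∑ a, r a * Kop k f (Function.update b i a) ^ 2) = S at *
  have h2 : 0 ≤ 1 - ρ := by linarith
  have h3 := mul_le_mul_of_nonneg_left hc h2
  nlinarith [mul_nonneg (sq_nonneg (1-ρ)) (sub_nonneg.2 h1)]

end ker

/-! ### Hypercontractivity -/

lemma hc_scalar {w c ρ Bd : ℝ} (hw : 0 ≤ w) (hwB : w ≤ Bd) (hB : 1 ≤ Bd) (hc : 0 < c)
    (hρ0 : 0 ≤ ρ) (h : c * (2 + Bd) ≤ 1 - ρ) :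
    1 + (2 - c) * (w - 1) + ρ * (w - 1) ^ 2 ≤ w ^ (2 - c) := by
  have hc1 : c ≤ 1 - ρ := by nlinarith
  rcases hw.eq_or_lt with h0 | h0
  · subst h0
    rw [Real.zero_rpow (by nlinarith)]
    nlinarith
  · have h1 : w ^ (2 - c) = w ^ 2 * w ^ (-c) := by
      rw [sub_eq_add_neg, Real.rpow_add h0]; norm_num
    have h2 : 1 - c * (w - 1) ≤ w ^ (-c) := by
      rw [Real.rpow_def_of_pos h0]
      have := Real.add_one_le_exp (Real.log w * (-c))
      have := Real.log_le_sub_one_of_pos h0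
      nlinarith
    rw [h1]
    have h3 := mul_le_mul_of_nonneg_left h2 (sq_nonneg w)
    refine le_trans ?_ h3
    have h4 : ρ ≤ 1 - 2 * c - c * (w - 1) := by nlinarith
    have h5 := mul_le_mul_of_nonneg_left h4 (sq_nonneg (w - 1))
    nlinarith

lemma hc_one {B : Type} [Fintype B] {r Ψ : B → ℝ} {c ρ Bd : ℝ} (hr : ∀ b, 0 < r b)
    (hr1 : ∑ b, r b = 1) (hrB : ∀ b, 1 ≤ r b * Bd) (hB : 1 ≤ Bd) (hc : 0 < c)
    (hρ0 : 0 ≤ ρ) (h : c * (2 + Bd) ≤ 1 - ρ) (hΨ : ∀ b, 0 ≤ Ψ b) :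
    (∑ b, r b * Ψ b) ^ 2 + ρ * ∑ b, r b * (Ψ b - ∑ b, r b * Ψ b) ^ 2
      ≤ (∑ b, r b * Ψ b ^ (2 - c)) ^ (2 / (2 - c)) := by
  have hc1 : c ≤ 1 - ρ := by nlinarith
  have hq : 0 < 2 - c := by linarith
  set m := ∑ b, r b * Ψ b with hm
  have hm0 : 0 ≤ m := Finset.sum_nonneg fun b _ => mul_nonneg (hr b).le (hΨ b)
  have hS0 : 0 ≤ ∑ b, r b * Ψ b ^ (2 - c) :=
    Finset.sum_nonneg fun b _ => mul_nonneg (hr b).le (Real.rpow_nonneg (hΨ b) _)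
  rcases hm0.eq_or_lt with h0 | h0
  · have : ∀ b, Ψ b = 0 := by
      intro b
      have := (Finset.sum_eq_zero_iff_of_nonneg
        (fun b _ => mul_nonneg (hr b).le (hΨ b))).1 (hm.symm.trans h0.symm) b (Finset.mem_univ b)
      rcases mul_eq_zero.1 this with h | h
      · exact absurd h (hr b).ne'
      · exact h
    rw [← h0]
    simp only [this]
    simp
    exact Real.rpow_nonneg (by rw [← Finset.sum_mul]; exact mul_nonneg (by rw [hr1]; norm_num) (Real.rpow_nonneg le_rfl _)) _
  · have hw : ∀ b, Ψ b / m ≤ Bd := by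
      intro b
      rw [div_le_iff₀ h0]
      have h1 : r b * Ψ b ≤ m :=
        Finset.single_le_sum (f := fun b => r b * Ψ b)
          (fun b _ => mul_nonneg (hr b).le (hΨ b)) (Finset.mem_univ b)
      have := hrB b
      have := hΨ b
      nlinarith
    have hpt : ∀ b, r b * (1 + (2 - c) * (Ψ b / m - 1) + ρ * (Ψ b / m - 1) ^ 2)
        ≤ r b * (Ψ b / m) ^ (2 - c) := fun b =>
      mul_le_mul_of_nonneg_left
        (hc_scalar (div_nonneg (hΨ b) hm0) (hw b) hB hc hρ0 h) (hr b).le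
    have hs := Finset.sum_le_sum fun b (_ : b ∈ Finset.univ) => hpt b
    set V := ∑ b, r b * (Ψ b - m) ^ 2 with hV
    have hV0 : 0 ≤ V := Finset.sum_nonneg fun b _ => mul_nonneg (hr b).le (sq_nonneg _)
    have e1 : ∑ b, r b * (1 + (2 - c) * (Ψ b / m - 1) + ρ * (Ψ b / m - 1) ^ 2)
        = 1 + ρ * (V / m ^ 2) := by
      have : ∀ b, r b * (1 + (2 - c) * (Ψ b / m - 1) + ρ * (Ψ b / m - 1) ^ 2)
          = (1 - (2 - c)) * r b + ((2 - c) / m) * (r b * Ψ b)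
            + (ρ / m ^ 2) * (r b * (Ψ b - m) ^ 2) := by
        intro b; field_simp; ring
      simp only [this, Finset.sum_add_distrib, ← Finset.mul_sum, ← hm, ← hV, hr1]
      field_simp
      ring
    have e2 : ∑ b, r b * (Ψ b / m) ^ (2 - c) = (∑ b, r b * Ψ b ^ (2 - c)) / m ^ (2 - c) := by
      rw [Finset.sum_div]
      refine Finset.sum_congr rfl fun b _ => ?_
      rw [Real.div_rpow (hΨ b) hm0]; ring
    rw [e1, e2, le_div_iff₀ (Real.rpow_pos_of_pos h0 _)] at hs
    have hx : 0 ≤ ρ * (V / m ^ 2) := by positivity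
    have h2q : 1 ≤ 2 / (2 - c) := by rw [le_div_iff₀ hq]; linarith
    calc m ^ 2 + ρ * V = (1 + ρ * (V / m ^ 2)) * m ^ 2 := by field_simp
      _ ≤ (1 + ρ * (V / m ^ 2)) ^ (2 / (2 - c)) * m ^ 2 := by
          refine mul_le_mul_of_nonneg_right ?_ (sq_nonneg m)
          exact Real.self_le_rpow_of_one_le (by linarith) h2q
      _ = ((1 + ρ * (V / m ^ 2)) * m ^ (2 - c)) ^ (2 / (2 - c)) := by
          rw [Real.mul_rpow (by linarith) (Real.rpow_nonneg hm0 _), ← Real.rpow_mul hm0]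
          congr 1
          rw [mul_div_cancel₀ _ hq.ne']
          norm_num
      _ ≤ _ := Real.rpow_le_rpow (by positivity) hs (by positivity)

lemma cs_scalar {ub m X Vu A : ℝ} (hA : 0 ≤ A) (hVu : 0 ≤ Vu) (hX : X ^ 2 ≤ Vu * A) :
    (ub * m + X) ^ 2 ≤ (ub ^ 2 + Vu) * (m ^ 2 + A) := by
  have h1 : |2 * (ub * m * X)| ≤ ub ^ 2 * A + Vu * m ^ 2 := by
    apply abs_le_of_sq_le_sq _ (by positivity)
    have := mul_le_mul_of_nonneg_left hX (sq_nonneg (ub * m))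
    nlinarith [sq_nonneg (ub ^ 2 * A - Vu * m ^ 2)]
  have := (abs_le.1 h1).2
  nlinarith

lemma wcs {α : Type} [Fintype α] (w f g : α → ℝ) (hw : ∀ a, 0 ≤ w a) :
    (∑ a, w a * (f a * g a)) ^ 2 ≤ (∑ a, w a * f a ^ 2) * ∑ a, w a * g a ^ 2 := by
  have := Finset.sum_mul_sq_le_sq_mul_sq Finset.univ (fun a => √(w a) * f a) (fun a => √(w a) * g a)
  have e : ∀ a, √(w a) * √(w a) = w a := fun a => Real.mul_self_sqrt (hw a)
  have e1 : ∀ a, √(w a) * f a * (√(w a) * g a) = w a * (f a * g a) := fun a => by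
    calc _ = (√(w a) * √(w a)) * (f a * g a) := by ring
      _ = _ := by rw [e a]
  have e2 : ∀ (f : α → ℝ) a, (√(w a) * f a) ^ 2 = w a * f a ^ 2 := fun f a => by
    rw [mul_pow, Real.sq_sqrt (hw a)]
  simpa only [e1, e2] using this

section hc
variable {Ω B : Type} [Fintype Ω] [Fintype B] {p : Ω → ℝ} {r : B → ℝ} {k : B → Ω → ℝ} {ρ : ℝ}
  {n : ℕ}

lemma hc_base (hK : Ker p r k ρ) {c Bd : ℝ} (hrB : ∀ b, 1 ≤ r b * Bd) (hB : 1 ≤ Bd) (hc : 0 < c)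
    (h : c * (2 + Bd) ≤ 1 - ρ) (u : Ω → ℝ) {Ψ : B → ℝ} (hΨ : ∀ b, 0 ≤ Ψ b) :
    ∑ b, r b * ((∑ x, k b x * u x) * Ψ b)
      ≤ (∑ x, p x * u x ^ 2) ^ (1 / 2 : ℝ) * (∑ b, r b * Ψ b ^ (2 - c)) ^ (1 / (2 - c)) := by
  have hρ0 := hK.hρ0
  have hr : ∀ b, 0 ≤ r b := fun b => (hK.hr b).le
  have hc1 : c ≤ 1 - ρ := by nlinarith
  have hq : 0 < 2 - c := by linarith
  have h1 := hc_one hK.hr hK.hr1 hrB hB hc hρ0 h hΨ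
  have hS0 : 0 ≤ ∑ b, r b * Ψ b ^ (2 - c) :=
    Finset.sum_nonneg fun b _ => mul_nonneg (hr b) (Real.rpow_nonneg (hΨ b) _)
  set S := ∑ b, r b * Ψ b ^ (2 - c)
  set m := ∑ b, r b * Ψ b with hm
  set ub := ∑ x, p x * u x with hub
  have hmean := hK.mean u
  rw [← hub] at hmean
  set Ku : B → ℝ := fun b => ∑ x, k b x * u x with hKu
  have hmean' : ∑ b, r b * Ku b = ub := hmean
  have hU0 : 0 ≤ ∑ x, p x * u x ^ 2 :=
    Finset.sum_nonneg fun x _ => mul_nonneg (hK.hp x) (sq_nonneg _)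
  have e : ∑ b, r b * (Ku b * Ψ b) = ub * m + ∑ b, r b * ((Ku b - ub) * (Ψ b - m)) := by
    have : ∀ b, r b * ((Ku b - ub) * (Ψ b - m)) = r b * (Ku b * Ψ b) - m * (r b * Ku b)
        - ub * (r b * Ψ b) + ub * m * r b := fun b => by ring
    simp only [this, Finset.sum_add_distrib, Finset.sum_sub_distrib, ← Finset.mul_sum, hmean',
      ← hm, hK.hr1]
    ring
  have hX := wcs r (fun b => Ku b - ub) (fun b => Ψ b - m) hr
  have hv := var_eq r Ku hK.hr1
  rw [hmean'] at hv
  have hcon := hK.contr u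
  rw [← hub] at hcon
  have hj := sq_sum_le p u hK.hp hK.hp1
  rw [← hub] at hj
  have hVp : 0 ≤ ∑ b, r b * (Ψ b - m) ^ 2 :=
    Finset.sum_nonneg fun x _ => mul_nonneg (hr x) (sq_nonneg _)
  have hX2 : (∑ b, r b * ((Ku b - ub) * (Ψ b - m))) ^ 2
      ≤ (∑ x, p x * u x ^ 2 - ub ^ 2) * (ρ * ∑ b, r b * (Ψ b - m) ^ 2) := by
    refine hX.trans ?_
    have : ∑ b, r b * (Ku b - ub) ^ 2 ≤ ρ * (∑ x, p x * u x ^ 2 - ub ^ 2) := by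
      rw [hv]; linarith
    calc _ ≤ ρ * (∑ x, p x * u x ^ 2 - ub ^ 2) * ∑ b, r b * (Ψ b - m) ^ 2 :=
          mul_le_mul_of_nonneg_right this hVp
      _ = _ := by ring
  have h2 := cs_scalar (ub := ub) (m := m) (mul_nonneg hρ0 hVp) (sub_nonneg.2 hj) hX2
  rw [← e] at h2
  have h3 : (∑ b, r b * (Ku b * Ψ b)) ^ 2 ≤ (∑ x, p x * u x ^ 2) * S ^ (2 / (2 - c)) := by
    refine h2.trans ?_
    rw [add_sub_cancel]
    exact mul_le_mul_of_nonneg_left h1 hU0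
  have h4 := Real.le_sqrt_of_sq_le h3
  refine h4.trans (le_of_eq ?_)
  rw [Real.sqrt_eq_rpow, Real.mul_rpow hU0 (Real.rpow_nonneg hS0 _), ← Real.rpow_mul hS0]
  congr 2
  field_simp

lemma wE_succ {α : Type} [Fintype α] (w : Fin (n + 1) → α → ℝ) (f : (Fin (n + 1) → α) → ℝ) :
    wE w f = ∑ a, w 0 a * wE (fun i => w i.succ) (fun x => f (Fin.cons a x)) := by
  unfold wE
  rw [← (Fin.consEquiv (fun _ => α)).sum_comp, Fintype.sum_prod_type]
  refine Finset.sum_congr rfl fun a _ => ?_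
  rw [Finset.mul_sum]
  refine Finset.sum_congr rfl fun x _ => ?_
  simp [Fin.consEquiv, Fin.prod_univ_succ]
  ring

lemma wE_zero {α : Type} [Fintype α] (w : Fin 0 → α → ℝ) (f : (Fin 0 → α) → ℝ) :
    wE w f = f Fin.elim0 := by
  unfold wE
  rw [Fintype.sum_unique]
  simp
  congr 1

lemma Kop_cons (f : (Fin (n + 1) → Ω) → ℝ) (β : B) (b : Fin n → B) :
    Kop k f (Fin.cons β b) = ∑ a, k β a * Kop k (fun x => f (Fin.cons a x)) b := by
  unfold Kop
  rw [wE_succ]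
  simp

lemma hc_tensor (hK : Ker p r k ρ) {c Bd : ℝ} (hrB : ∀ b, 1 ≤ r b * Bd) (hB : 1 ≤ Bd) (hc : 0 < c)
    (h : c * (2 + Bd) ≤ 1 - ρ) : ∀ (n : ℕ) (u : (Fin n → Ω) → ℝ) (Ψ : (Fin n → B) → ℝ),
      (∀ b, 0 ≤ Ψ b) → 
    pE r (fun b => Kop k u b * Ψ b)
      ≤ (pE p fun x => u x ^ 2) ^ (1 / 2 : ℝ) * (pE r fun b => Ψ b ^ (2 - c)) ^ (1 / (2 - c)) := by
  have hρ0 := hK.hρ0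
  have hr : ∀ b, 0 ≤ r b := fun b => (hK.hr b).le
  have hc1 : c ≤ 1 - ρ := by nlinarith
  have hq : 0 < 2 - c := by linarith
  intro n
  induction n with
  | zero =>
    intro u Ψ hΨ
    simp only [pE, Kop, wE_zero]
    rw [← Real.rpow_mul (hΨ _), mul_one_div_cancel hq.ne', Real.rpow_one, ← Real.sqrt_eq_rpow,
      Real.sqrt_sq_eq_abs]
    exact mul_le_mul_of_nonneg_right (le_abs_self _) (hΨ _)
  | succ n ih =>
    intro u Ψ hΨ
    set U : Ω → ℝ := fun a => (pE p fun x => u (Fin.cons a x) ^ 2) ^ (1 / 2 : ℝ) with hU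
    set Φ : B → ℝ := fun β => (pE r fun b => Ψ (Fin.cons β b) ^ (2 - c)) ^ (1 / (2 - c)) with hΦ
    have n1 : ∀ a, 0 ≤ pE p fun x : Fin n → Ω => u (Fin.cons a x) ^ 2 := fun a =>
      wE_nonneg _ (fun _ => hK.hp) fun x => sq_nonneg _
    have n2 : ∀ β, 0 ≤ pE r fun b : Fin n → B => Ψ (Fin.cons β b) ^ (2 - c) := fun β =>
      wE_nonneg _ (fun _ => hr) fun x => Real.rpow_nonneg (hΨ _) _
    have hb := hc_base hK hrB hB hc h U (Ψ := Φ) (fun b => Real.rpow_nonneg (n2 b) _)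
    have eU : ∑ x, p x * U x ^ 2 = pE p fun x => u x ^ 2 := by
      rw [pE, wE_succ]
      refine Finset.sum_congr rfl fun a _ => ?_
      congr 1
      simp only [hU]
      rw [← Real.rpow_natCast, ← Real.rpow_mul (n1 a)]
      norm_num
    have eΦ : ∑ b, r b * Φ b ^ (2 - c) = pE r fun b => Ψ b ^ (2 - c) := by
      rw [pE, wE_succ]
      refine Finset.sum_congr rfl fun a _ => ?_
      congr 1
      simp only [hΦ]
      rw [← Real.rpow_mul (n2 a), one_div_mul_cancel hq.ne', Real.rpow_one]
    rw [eU, eΦ] at hb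
    refine le_trans ?_ hb
    rw [pE, wE_succ]
    refine Finset.sum_le_sum fun β _ => mul_le_mul_of_nonneg_left ?_ (hr β)
    have : ∀ b : Fin n → B, Kop k u (Fin.cons β b) * Ψ (Fin.cons β b)
        = ∑ a, k β a * (Kop k (fun x => u (Fin.cons a x)) b * Ψ (Fin.cons β b)) := by
      intro b
      rw [Kop_cons, Finset.sum_mul]
      exact Finset.sum_congr rfl fun a _ => by ring
    simp only [this]
    rw [wE_sum, Finset.sum_mul]
    refine Finset.sum_le_sum fun a _ => ?_
    rw [wE_smul, mul_assoc]
    refine mul_le_mul_of_nonneg_left ?_ (hK.hk β a)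
    exact ih (fun x => u (Fin.cons a x)) (fun b => Ψ (Fin.cons β b)) fun b => hΨ _

lemma cube_bound (hK : Ker p r k ρ) {c Bd τ : ℝ} (hrB : ∀ b, 1 ≤ r b * Bd) (hB : 1 ≤ Bd)
    (hc : 0 < c) (h : c * (2 + Bd) ≤ 1 - ρ) (f : (Fin n → Ω) → ℝ)
    (hf : ∀ x, f x ∈ Set.Icc (0:ℝ) 1) (i : Fin n) (hτ : Infl p r k i f ≤ τ) :
    pE r (fun b => |Kop k (fun x => f x - Eop p i f x) b| ^ 3)
      ≤ (pE p (fun x => f x ^ 2) - pE p (fun x => Eop p i f x ^ 2)) * τ ^ (1 / (2 - c) - 1 / 2) := by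
  have hρ0 := hK.hρ0
  have hr : ∀ b, 0 ≤ r b := fun b => (hK.hr b).le
  have hc1 : c ≤ 1 - ρ := by nlinarith
  have hq : 0 < 2 - c := by linarith
  rw [← pE_sq_sub hK.hp1]
  have hI0 := Infl_nonneg hK i f
  have hIQ : Infl p r k i f ≤ pE p (fun x => (f x - Eop p i f x) ^ 2) := pE_Kop_sq_le hK _
  set g : (Fin n → Ω) → ℝ := fun x => f x - Eop p i f x with hg
  have hg1 : ∀ x, |g x| ≤ 1 := by
    intro x
    have h1 := hf x
    have h2 := Eop_mem hK.hp hK.hp1 hf i x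
    rw [abs_le]
    constructor <;> simp only [hg] <;> linarith [h1.1, h1.2, h2.1, h2.2]
  set D := Kop k g with hD
  have hDle : ∀ b, |D b| ≤ Kop k (fun x => |g x|) b := fun b =>
    wE_abs_le _ (fun i a => hK.hk _ _) g
  have hD1 : ∀ b, |D b| ≤ 1 := fun b => by
    refine (hDle b).trans ((wE_mono _ (fun i a => hK.hk _ _) hg1).trans (le_of_eq ?_))
    exact wE_const _ (fun i => hK.hk1 _) 1
  have h1 : pE r (fun b => |D b| ^ 3) ≤ pE r (fun b => Kop k (fun x => |g x|) b * |D b| ^ 2) :=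
    wE_mono _ (fun _ => hr) fun b => by
      have := mul_le_mul_of_nonneg_right (hDle b) (sq_nonneg |D b|)
      nlinarith
  refine h1.trans ((hc_tensor hK hrB hB hc h n _ _ fun b => sq_nonneg |D b|).trans ?_)
  simp only [sq_abs]
  have h2 : (pE r fun b => (D b ^ 2) ^ (2 - c)) ≤ Infl p r k i f :=
    wE_mono _ (fun _ => hr) fun b => by
      have hd : D b ^ 2 ≤ 1 := by rw [← sq_abs]; exact pow_le_one₀ (abs_nonneg _) (hD1 b)
      exact Real.rpow_le_self_of_le_one (sq_nonneg _) hd (by linarith)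
  have h20 : 0 ≤ (pE r fun b => (D b ^ 2) ^ (2 - c)) :=
    wE_nonneg _ (fun _ => hr) fun b => Real.rpow_nonneg (sq_nonneg _) _
  set Q := pE p (fun x => g x ^ 2) with hQ
  have hQ0 : 0 ≤ Q := hI0.trans hIQ
  have hγ : 0 ≤ 1 / (2 - c) - 1 / 2 := by
    rw [sub_nonneg]; exact one_div_le_one_div_of_le hq (by linarith)
  have h3 : (pE r fun b => (D b ^ 2) ^ (2 - c)) ^ (1 / (2 - c))
      ≤ Q ^ (1 / 2 : ℝ) * τ ^ (1 / (2 - c) - 1 / 2) := by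
    calc _ ≤ (Infl p r k i f) ^ (1 / (2 - c)) := Real.rpow_le_rpow h20 h2 (by positivity)
      _ = (Infl p r k i f) ^ (1 / 2 : ℝ) * (Infl p r k i f) ^ (1 / (2 - c) - 1 / 2) := by
          rw [← Real.rpow_add_of_nonneg hI0 (by norm_num) hγ]; congr 1; ring
      _ ≤ _ := by
          apply mul_le_mul (Real.rpow_le_rpow hI0 hIQ (by norm_num))
            (Real.rpow_le_rpow hI0 hτ hγ) (Real.rpow_nonneg hI0 _) (Real.rpow_nonneg hQ0 _)
  calc _ ≤ Q ^ (1 / 2 : ℝ) * (Q ^ (1 / 2 : ℝ) * τ ^ (1 / (2 - c) - 1 / 2)) :=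
        mul_le_mul_of_nonneg_left h3 (Real.rpow_nonneg hQ0 _)
    _ = _ := by
        rw [← mul_assoc, ← Real.rpow_add_of_nonneg hQ0 (by norm_num) (by norm_num)]
        norm_num

end hc

/-! ### The one-coordinate inequality -/

lemma one_step_charge {r d u v C ε : ℝ} {m : ℕ} (hm : 4 ≤ m) (hu0 : 0 ≤ u) (hu1 : u ≤ 1)
    (hv0 : 0 ≤ v) (hv1 : v ≤ 1) (hr : 0 ≤ r) (hC : 1 ≤ r * (C * ε ^ 3)) (hC0 : 0 ≤ C)
    (hε : 0 ≤ ε) (hd : ε * u ≤ |d|) :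
    u ^ (2 * m) * v ^ (2 * m) ≤ C * (r * |d| ^ 3) := by
  have h1 : u ^ (2 * m) * v ^ (2 * m) ≤ u ^ 3 := by
    calc _ ≤ u ^ (2 * m) * 1 :=
          mul_le_mul_of_nonneg_left (pow_le_one₀ hv0 hv1) (pow_nonneg hu0 _)
      _ ≤ u ^ 3 := by rw [mul_one]; exact pow_le_pow_of_le_one hu0 hu1 (by omega)
  have h2 : (ε * u) ^ 3 ≤ |d| ^ 3 := pow_le_pow_left₀ (by positivity) hd 3
  calc _ ≤ u ^ 3 := h1
    _ ≤ (r * (C * ε ^ 3)) * u ^ 3 := le_mul_of_one_le_left (by positivity) hC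
    _ = C * (r * (ε * u) ^ 3) := by ring
    _ ≤ _ := by gcongr

lemma bern_scalar {a b : ℝ} {m : ℕ} (hm : 4 ≤ m) (ha : |a| ≤ 1 / (3 * m)) (hb : |b| ≤ 1 / (3 * m)) :
    1 + 2 * m * (a + b) + 2 * m * (a * b) + m ^ 2 * ((a + b) ^ 2 / 2) - (a ^ 2 + b ^ 2)
      ≤ ((1 + a) * (1 + b)) ^ (2 * m) := by
  have hm' : (4:ℝ) ≤ m := by exact_mod_cast hm
  have hm0 : (0:ℝ) < m := by linarith
  have hma : |m * a| ≤ 1 / 3 := by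
    rw [abs_mul, abs_of_pos hm0]
    calc (m:ℝ) * |a| ≤ m * (1 / (3 * m)) := by gcongr
      _ = 1 / 3 := by field_simp
  have hmb : |m * b| ≤ 1 / 3 := by
    rw [abs_mul, abs_of_pos hm0]
    calc (m:ℝ) * |b| ≤ m * (1 / (3 * m)) := by gcongr
      _ = 1 / 3 := by field_simp
  have hb1 : |b| ≤ 1 := hb.trans (by rw [div_le_one (by positivity)]; linarith)
  have hmab : |m * (a * b)| ≤ 1 / 3 := by
    rw [← mul_assoc, abs_mul]
    calc |m * a| * |b| ≤ (1 / 3) * 1 := by gcongr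
      _ = 1 / 3 := by norm_num
  set t := a + b + a * b with ht
  have ht1 : (1 + a) * (1 + b) = 1 + t := by rw [ht]; ring
  have hmt : -1 ≤ m * t := by
    have := (abs_le.1 hma).1
    have := (abs_le.1 hmb).1
    have := (abs_le.1 hmab).1
    rw [ht]; nlinarith
  have ht2 : -2 ≤ t := by nlinarith
  have hB := one_add_mul_le_pow ht2 m
  have hsq : (1 + m * t) ^ 2 ≤ ((1 + t) ^ m) ^ 2 := pow_le_pow_left₀ (by linarith) hB 2
  rw [ht1, mul_comm 2 m, pow_mul]
  refine le_trans ?_ hsq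
  have hab2 : (m * (a * b)) ^ 2 ≤ a ^ 2 := by
    have : (m * (a * b)) ^ 2 = (m * b) ^ 2 * a ^ 2 := by ring
    rw [this]
    have : (m * b) ^ 2 ≤ 1 := by
      rw [← sq_abs]; exact pow_le_one₀ (abs_nonneg _) (by linarith)
    exact mul_le_of_le_one_left (sq_nonneg _) this
  have : (1 + m * t) ^ 2 = 1 + 2 * m * (a + b) + 2 * m * (a * b) + (m * (a + b) + m * (a * b)) ^ 2 := by
    rw [ht]; ring
  rw [this]
  nlinarith [sq_nonneg (m * (a + b) + 2 * (m * (a * b))), sq_nonneg b]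

lemma one_step {B : Type} [Fintype B] {r U V : B → ℝ} {κ C : ℝ} {m : ℕ} (hm : 4 ≤ m)
    (hκm : 4 ≤ κ * m) (hr : ∀ b, 0 < r b) (hr1 : ∑ b, r b = 1)
    (hC0 : 0 ≤ C) (hC : ∀ b, 1 ≤ r b * (C * (1 / (3 * m)) ^ 3))
    (hU : ∀ b, U b ∈ Set.Icc (0:ℝ) 1) (hV : ∀ b, V b ∈ Set.Icc (0:ℝ) 1)
    {u v : ℝ} (hu : u = ∑ b, r b * U b) (hv : v = ∑ b, r b * V b)
    (star : ∀ x y : ℝ, κ * (∑ b, r b * (x * (U b - u)) ^ 2 + ∑ b, r b * (y * (V b - v)) ^ 2)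
      ≤ ∑ b, r b * (x * (U b - u) + y * (V b - v)) ^ 2) :
    u ^ (2 * m) * v ^ (2 * m) ≤ ∑ b, r b * (U b ^ (2 * m) * V b ^ (2 * m))
      + C * (∑ b, r b * |U b - u| ^ 3 + ∑ b, r b * |V b - v| ^ 3) := by
  have hm' : (4:ℝ) ≤ m := by exact_mod_cast hm
  have hm0 : (0:ℝ) < m := by linarith
  have mean_mem : ∀ W : B → ℝ, (∀ b, W b ∈ Set.Icc (0:ℝ) 1) → 
      0 ≤ ∑ b, r b * W b ∧ ∑ b, r b * W b ≤ 1 := by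
    intro W hW
    refine ⟨Finset.sum_nonneg fun b _ => mul_nonneg (hr b).le (hW b).1, ?_⟩
    rw [← hr1]
    exact Finset.sum_le_sum fun b _ => mul_le_of_le_one_right (hr b).le (hW b).2
  obtain ⟨hu0, hu1⟩ := mean_mem U hU
  obtain ⟨hv0, hv1⟩ := mean_mem V hV
  rw [← hu] at hu0 hu1
  rw [← hv] at hv0 hv1
  have hS0 : 0 ≤ ∑ b, r b * (U b ^ (2 * m) * V b ^ (2 * m)) :=
    Finset.sum_nonneg fun b _ => mul_nonneg (hr b).le
      (mul_nonneg (pow_nonneg (hU b).1 _) (pow_nonneg (hV b).1 _))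
  have hA0 : ∀ b, 0 ≤ r b * |U b - u| ^ 3 := fun b => mul_nonneg (hr b).le (by positivity)
  have hB0 : ∀ b, 0 ≤ r b * |V b - v| ^ 3 := fun b => mul_nonneg (hr b).le (by positivity)
  have hA := Finset.sum_nonneg fun b (_ : b ∈ Finset.univ) => hA0 b
  have hB := Finset.sum_nonneg fun b (_ : b ∈ Finset.univ) => hB0 b
  by_cases h1 : ∃ b, 1 / (3 * m) * u < |U b - u|
  · obtain ⟨b, hb⟩ := h1
    have h2 := one_step_charge hm hu0 hu1 hv0 hv1 (hr b).le (hC b) hC0 (by positivity) hb.le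
    have h3 := Finset.single_le_sum (fun b _ => hA0 b) (Finset.mem_univ b)
    have h4 := mul_le_mul_of_nonneg_left h3 hC0
    have h5 := mul_nonneg hC0 hB
    rw [mul_add]; linarith
  by_cases h1' : ∃ b, 1 / (3 * m) * v < |V b - v|
  · obtain ⟨b, hb⟩ := h1'
    have h2 := one_step_charge hm hv0 hv1 hu0 hu1 (hr b).le (hC b) hC0 (by positivity) hb.le
    have h3 := Finset.single_le_sum (fun b _ => hB0 b) (Finset.mem_univ b)
    have h4 := mul_le_mul_of_nonneg_left h3 hC0
    have h5 := mul_nonneg hC0 hA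
    rw [mul_add, mul_comm (u ^ _)]; linarith
  push Not at h1 h1'
  have hE0 : 0 ≤ C * (∑ b, r b * |U b - u| ^ 3 + ∑ b, r b * |V b - v| ^ 3) :=
    mul_nonneg hC0 (add_nonneg hA hB)
  rcases hu0.eq_or_lt with h0 | hup
  · rw [← h0, zero_pow (by omega), zero_mul]; rw [← h0] at hE0; linarith
  rcases hv0.eq_or_lt with h0 | hvp
  · rw [← h0, zero_pow (by omega), mul_zero]; rw [← h0] at hE0; linarith
  refine le_trans ?_ (le_add_of_nonneg_right hE0)
  set a : B → ℝ := fun b => 1 / u * (U b - u) with ha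
  set b' : B → ℝ := fun b => 1 / v * (V b - v) with hb'
  have hae : ∀ b, |a b| ≤ 1 / (3 * m) := fun b => by
    simp only [ha]
    rw [abs_mul, abs_of_pos (by positivity : 0 < 1 / u), one_div_mul_eq_div, div_le_iff₀ hup]
    exact h1 b
  have hbe : ∀ b, |b' b| ≤ 1 / (3 * m) := fun b => by
    simp only [hb']
    rw [abs_mul, abs_of_pos (by positivity : 0 < 1 / v), one_div_mul_eq_div, div_le_iff₀ hvp]
    exact h1' b
  have st := star (1 / u) (1 / v)
  change κ * (∑ b, r b * (a b) ^ 2 + ∑ b, r b * (b' b) ^ 2) ≤ ∑ b, r b * (a b + b' b) ^ 2 at st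
  have hsum := Finset.sum_le_sum fun b (_ : b ∈ Finset.univ) =>
    mul_le_mul_of_nonneg_left (bern_scalar hm (hae b) (hbe b)) (hr b).le
  have ea : ∑ b, r b * a b = 0 := by
    have : ∀ b, r b * a b = 1 / u * (r b * U b) - r b := fun b => by
      simp only [ha]; field_simp
    simp only [this, Finset.sum_sub_distrib, ← Finset.mul_sum, ← hu, hr1]
    field_simp; ring
  have eb : ∑ b, r b * b' b = 0 := by
    have : ∀ b, r b * b' b = 1 / v * (r b * V b) - r b := fun b => by
      simp only [hb']; field_simp
    simp only [this, Finset.sum_sub_distrib, ← Finset.mul_sum, ← hv, hr1]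
    field_simp; ring
  have e1 : ∀ b, r b * (U b ^ (2 * m) * V b ^ (2 * m))
      = u ^ (2 * m) * v ^ (2 * m) * (r b * ((1 + a b) * (1 + b' b)) ^ (2 * m)) := by
    intro b
    have hx : U b = u * (1 + a b) := by simp only [ha]; field_simp; ring
    have hy : V b = v * (1 + b' b) := by simp only [hb']; field_simp; ring
    rw [hx, hy, mul_pow, mul_pow, mul_pow]; ring
  simp only [e1, ← Finset.mul_sum]
  refine le_mul_of_one_le_right (by positivity) (le_trans ?_ hsum)
  have hab : -(∑ b, r b * (a b) ^ 2 + ∑ b, r b * (b' b) ^ 2) / 2 ≤ ∑ b, r b * (a b * b' b) := by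
    have : 0 ≤ ∑ b, r b * (a b + b' b) ^ 2 :=
      Finset.sum_nonneg fun b _ => mul_nonneg (hr b).le (sq_nonneg _)
    have e : ∀ b, r b * (a b + b' b) ^ 2 = r b * a b ^ 2 + r b * b' b ^ 2 + 2 * (r b * (a b * b' b)) :=
      fun b => by ring
    simp only [e, Finset.sum_add_distrib, ← Finset.mul_sum] at this
    linarith
  have e2 : ∀ b, r b * (1 + 2 * m * (a b + b' b) + 2 * m * (a b * b' b)
      + m ^ 2 * ((a b + b' b) ^ 2 / 2) - (a b ^ 2 + b' b ^ 2))
      = r b + 2 * m * (r b * a b) + 2 * m * (r b * b' b) + 2 * m * (r b * (a b * b' b))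
        + m ^ 2 / 2 * (r b * (a b + b' b) ^ 2) - r b * a b ^ 2 - r b * b' b ^ 2 := fun b => by ring
  simp only [e2, Finset.sum_add_distrib, Finset.sum_sub_distrib, ← Finset.mul_sum, ea, eb, hr1]
  have hDa : 0 ≤ ∑ b, r b * a b ^ 2 :=
    Finset.sum_nonneg fun b _ => mul_nonneg (hr b).le (sq_nonneg _)
  have hDb : 0 ≤ ∑ b, r b * b' b ^ 2 :=
    Finset.sum_nonneg fun b _ => mul_nonneg (hr b).le (sq_nonneg _)
  generalize (∑ b, r b * a b ^ 2) = Da at *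
  generalize (∑ b, r b * b' b ^ 2) = Db at *
  generalize (∑ b, r b * (a b + b' b) ^ 2) = S at *
  generalize (∑ b, r b * (a b * b' b)) = X at *
  have g1 : m ^ 2 / 2 * (κ * (Da + Db)) ≤ m ^ 2 / 2 * S := by gcongr
  have g2 : 2 * m * (Da + Db) ≤ m ^ 2 / 2 * (κ * (Da + Db)) := by
    have : (2 * m : ℝ) ≤ m ^ 2 / 2 * κ := by nlinarith
    calc _ ≤ m ^ 2 / 2 * κ * (Da + Db) := by gcongr
      _ = _ := by ring
  have g3 : 2 * m * (-(Da + Db) / 2) ≤ 2 * m * X := by gcongr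
  nlinarith

/-! ### Iterating over coordinates -/

/-- Two kernels which are jointly non degenerate. -/
structure KPair {Ω B : Type} [Fintype Ω] [Fintype B] (p : Ω → ℝ) (r : B → ℝ)
    (k1 k2 : B → Ω → ℝ) (ρ κ : ℝ) : Prop where
  K1 : Ker p r k1 ρ
  K2 : Ker p r k2 ρ
  star : ∀ u v : Ω → ℝ, ∑ x, p x * u x = 0 → ∑ x, p x * v x = 0 →
    κ * (∑ b, r b * (∑ x, k1 b x * u x) ^ 2 + ∑ b, r b * (∑ x, k2 b x * v x) ^ 2)
      ≤ ∑ b, r b * (∑ x, k1 b x * u x + ∑ x, k2 b x * v x) ^ 2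

section iter
variable {Ω B : Type} [Fintype Ω] [Fintype B] {p : Ω → ℝ} {r : B → ℝ} {k1 k2 : B → Ω → ℝ}
  {ρ κ : ℝ} {n : ℕ}

/-- the two-kernel correlation -/
noncomputable def Fop (r : B → ℝ) (k1 k2 : B → Ω → ℝ) (m : ℕ) (f : (Fin n → Ω) → ℝ) : ℝ :=
  pE r (fun b => Kop k1 f b ^ (2 * m) * Kop k2 f b ^ (2 * m))

lemma Ker.diff_eq {k : B → Ω → ℝ} (h : Ker p r k ρ) (f : (Fin n → Ω) → ℝ) (i : Fin n)
    (b : Fin n → B) (β : B) :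
    Kop k f (Function.update b i β) - Kop k (Eop p i f) b
      = ∑ a, k β a * (Kop k (fun x => f (Function.update x i a)) b
        - Kop k (Eop p i f) b) := by
  rw [Kop_update h.hk1]
  simp only [mul_sub, Finset.sum_sub_distrib, ← Finset.sum_mul, h.hk1, one_mul]

lemma Ker.diff_mean {k : B → Ω → ℝ} (h : Ker p r k ρ) (f : (Fin n → Ω) → ℝ) (i : Fin n)
    (b : Fin n → B) :
    ∑ a, p a * (Kop k (fun x => f (Function.update x i a)) b
        - Kop k (Eop p i f) b) = 0 := by
  simp only [mul_sub, Finset.sum_sub_distrib, ← Finset.sum_mul, h.hp1, one_mul]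
  rw [SameSetHitting.Kop_Eop, sub_self]

lemma Fop_step (hP : KPair p r k1 k2 ρ κ) {C : ℝ} {m : ℕ} (hm : 4 ≤ m)
    (hκm : 4 ≤ κ * m) (hC0 : 0 ≤ C) (hC : ∀ b, 1 ≤ r b * (C * (1 / (3 * m)) ^ 3))
    (f : (Fin n → Ω) → ℝ) (hf : ∀ x, f x ∈ Set.Icc (0:ℝ) 1) (i : Fin n) :
    Fop r k1 k2 m (Eop p i f) ≤ Fop r k1 k2 m f
      + C * (pE r (fun b => |Kop k1 (fun x => f x - Eop p i f x) b| ^ 3)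
        + pE r (fun b => |Kop k2 (fun x => f x - Eop p i f x) b| ^ 3)) := by
  have hr : ∀ b, 0 ≤ r b := fun b => (hP.K1.hr b).le
  unfold Fop
  rw [← wE_add, ← wE_smul, ← wE_add,
    wE_resample' (fun _ => r) i hP.K1.hr1 (fun b => _ + C * _)]
  refine wE_mono _ (fun _ => hr) fun b => ?_
  have e1 : ∀ β, Kop k1 (Eop p i f) (Function.update b i β) = Kop k1 (Eop p i f) b := fun β => by
    rw [hP.K1.Kop_Eop, hP.K1.Kop_Eop]; simp
  have e2 : ∀ β, Kop k2 (Eop p i f) (Function.update b i β) = Kop k2 (Eop p i f) b := fun β => by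
    rw [hP.K2.Kop_Eop, hP.K2.Kop_Eop]; simp
  have := one_step (r := r) (U := fun β => Kop k1 f (Function.update b i β))
    (V := fun β => Kop k2 f (Function.update b i β)) hm hκm hP.K1.hr hP.K1.hr1 hC0 hC
    (fun β => hP.K1.Kop_mem hf _) (fun β => hP.K2.Kop_mem hf _)
    (hP.K1.Kop_Eop f i b) (hP.K2.Kop_Eop f i b) ?_
  · refine this.trans (le_of_eq ?_)
    simp only [Kop_sub, e1, e2, mul_add, Finset.sum_add_distrib, Finset.mul_sum]
    congr 1
    congr 1 <;> exact Finset.sum_congr rfl fun β _ => by ring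
  · intro x y
    have := hP.star (fun a => x * (Kop k1 (fun x => f (Function.update x i a)) b
        - Kop k1 (Eop p i f) b)) (fun a => y * (Kop k2 (fun x => f (Function.update x i a)) b
        - Kop k2 (Eop p i f) b)) ?_ ?_
    · simp only [hP.K1.diff_eq, hP.K2.diff_eq]
      simpa only [mul_left_comm _ x, mul_left_comm _ y, ← Finset.mul_sum] using this
    · simp only [mul_left_comm _ x, ← Finset.mul_sum]
      rw [hP.K1.diff_mean, mul_zero]
    · simp only [mul_left_comm _ y, ← Finset.mul_sum]
      rw [hP.K2.diff_mean, mul_zero]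

/-- iterated averaging -/
noncomputable def EL (p : Ω → ℝ) : List (Fin n) → ((Fin n → Ω) → ℝ) → (Fin n → Ω) → ℝ
  | [], f => f
  | i :: L, f => EL p L (Eop p i f)

lemma EL_indep (L : List (Fin n)) : ∀ (f : (Fin n → Ω) → ℝ) (i : Fin n),
    (i ∈ L ∨ ∀ x a, f (Function.update x i a) = f x) →
      ∀ x a, EL p L f (Function.update x i a) = EL p L f x := by
  induction L with
  | nil => intro f i h; rcases h with h | h; · simp at h
           · exact h
  | cons j L ih =>
    intro f i h
    apply ih
    by_cases hij : i = j
    · right; subst hij; exact Eop_update f i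
    rcases h with h | h
    · left; simpa [hij] using h
    · right
      intro x a
      simp only [Eop]
      refine Finset.sum_congr rfl fun c _ => ?_
      rw [Function.update_comm hij, h]

lemma EL_const (hp1 : ∑ x, p x = 1) (f : (Fin n → Ω) → ℝ) :
    EL p (List.finRange n) f = fun _ => pE p f := by
  have hmean : ∀ (L : List (Fin n)) (f : (Fin n → Ω) → ℝ), pE p (EL p L f) = pE p f := by
    intro L
    induction L with
    | nil => intro f; rfl
    | cons j L ih => intro f; exact (ih _).trans (pE_Eop hp1 f j)
  set g := EL p (List.finRange n) f with hg
  have hi : ∀ i x a, g (Function.update x i a) = g x := fun i =>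
    EL_indep _ f i (Or.inl (List.mem_finRange i))
  have hc : ∀ x y, g x = g y := by
    intro x y
    have : ∀ S : Finset (Fin n), g (fun j => if j ∈ S then y j else x j) = g x := by
      intro S
      induction S using Finset.induction_on with
      | empty => simp
      | insert i S hi' ih =>
        rw [← ih, ← hi i (fun j => if j ∈ S then y j else x j) (y i)]
        congr 1
        funext j
        by_cases hj : j = i
        · subst hj; simp
        · simp [hj]
    have h1 := this Finset.univ
    simpa using h1.symm
  funext x
  rw [← hmean (List.finRange n) f, ← hg]
  have : g = fun _ => g x := funext fun y => hc y x
  conv_rhs => rw [this]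
  exact (wE_const (fun _ => p) (fun _ => hp1) _).symm

lemma Fop_EL (hP : KPair p r k1 k2 ρ κ) {C : ℝ} {m : ℕ} (hm : 4 ≤ m)
    (hκm : 4 ≤ κ * m) (hC0 : 0 ≤ C) (hC : ∀ b, 1 ≤ r b * (C * (1 / (3 * m)) ^ 3))
    {c Bd τ : ℝ} (hrB : ∀ b, 1 ≤ r b * Bd) (hB : 1 ≤ Bd)
    (hc : 0 < c) (h : c * (2 + Bd) ≤ 1 - ρ) (L : List (Fin n)) :
    ∀ (f : (Fin n → Ω) → ℝ), (∀ x, f x ∈ Set.Icc (0:ℝ) 1) → 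
    (∀ i, Infl p r k1 i f ≤ τ) → (∀ i, Infl p r k2 i f ≤ τ) →
    Fop r k1 k2 m (EL p L f) ≤ Fop r k1 k2 m f
      + 2 * C * τ ^ (1 / (2 - c) - 1 / 2)
        * (pE p (fun x => f x ^ 2) - pE p (fun x => EL p L f x ^ 2)) := by
  induction L with
  | nil => intro f _ _ _; simp [EL]
  | cons i L ih =>
    intro f hf h1 h2
    have a1 := ih (Eop p i f) (Eop_mem hP.K1.hp hP.K1.hp1 hf i)
      (fun j => (Infl_Eop_le hP.K1 j i f).trans (h1 j))
      (fun j => (Infl_Eop_le hP.K2 j i f).trans (h2 j))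
    have a2 := Fop_step hP hm hκm hC0 hC f hf i
    have a3 := cube_bound hP.K1 hrB hB hc h f hf i (h1 i)
    have a4 := cube_bound hP.K2 hrB hB hc h f hf i (h2 i)
    have a5 := mul_le_mul_of_nonneg_left (add_le_add a3 a4) hC0
    simp only [EL]
    linarith

lemma low_infl (hP : KPair p r k1 k2 ρ κ) {C : ℝ} {m : ℕ} (hm : 4 ≤ m)
    (hκm : 4 ≤ κ * m) (hC0 : 0 ≤ C) (hC : ∀ b, 1 ≤ r b * (C * (1 / (3 * m)) ^ 3))
    {c Bd τ : ℝ} (hrB : ∀ b, 1 ≤ r b * Bd) (hB : 1 ≤ Bd)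
    (hc : 0 < c) (h : c * (2 + Bd) ≤ 1 - ρ) (hτ : 0 ≤ τ)
    (f : (Fin n → Ω) → ℝ) (hf : ∀ x, f x ∈ Set.Icc (0:ℝ) 1)
    (h1 : ∀ i, Infl p r k1 i f ≤ τ) (h2 : ∀ i, Infl p r k2 i f ≤ τ) :
    pE p f ^ (2 * m) * pE p f ^ (2 * m) ≤ pE r (fun b => Kop k1 f b * Kop k2 f b)
      + 2 * C * τ ^ (1 / (2 - c) - 1 / 2) := by
  have hr : ∀ b, 0 ≤ r b := fun b => (hP.K1.hr b).le
  have a := Fop_EL hP hm hκm hC0 hC hrB hB hc h (List.finRange n) f hf h1 h2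
  rw [EL_const hP.K1.hp1] at a
  have e : Fop r k1 k2 m (fun _ : Fin n → Ω => pE p f) = pE p f ^ (2 * m) * pE p f ^ (2 * m) := by
    unfold Fop Kop
    simp only [wE_const _ (fun i => hP.K1.hk1 _), wE_const _ (fun i => hP.K2.hk1 _)]
    exact wE_const _ (fun _ => hP.K1.hr1) _
  rw [e] at a
  have b1 : pE p (fun x => f x ^ 2) ≤ 1 := by
    refine (wE_mono _ (fun _ => hP.K1.hp) (g := fun _ => 1) fun x => ?_).trans
      (wE_const _ (fun _ => hP.K1.hp1) _).le
    exact pow_le_one₀ (hf x).1 (hf x).2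
  have b2 : 0 ≤ pE p (fun x : Fin n → Ω => (fun _ => pE p f) x ^ 2) :=
    wE_nonneg _ (fun _ => hP.K1.hp) fun x => sq_nonneg _
  have b3 : 0 ≤ 2 * C * τ ^ (1 / (2 - c) - 1 / 2) := by positivity
  have b4 : Fop r k1 k2 m f ≤ pE r (fun b => Kop k1 f b * Kop k2 f b) := by
    refine wE_mono _ (fun _ => hr) fun b => ?_
    have q1 := hP.K1.Kop_mem hf b
    have q2 := hP.K2.Kop_mem hf b
    exact mul_le_mul (pow_le_of_le_one q1.1 q1.2 (by omega)) (pow_le_of_le_one q2.1 q2.2 (by omega))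
      (pow_nonneg q2.1 _) q1.1
  have b5 := mul_le_mul_of_nonneg_left (show pE p (fun x => f x ^ 2)
    - pE p (fun x : Fin n → Ω => (fun _ => pE p f) x ^ 2) ≤ 1 by linarith) b3
  linarith

end iter

/-! ### Greedy restriction -/

section greedy
variable {Ω B : Type} [Fintype Ω] [Fintype B] {p : Ω → ℝ} {r : B → ℝ} {k1 k2 : B → Ω → ℝ}
  {ρ κ : ℝ} {n : ℕ}

/-- the two point correlation -/
noncomputable def Gop (r : B → ℝ) (k1 k2 : B → Ω → ℝ) (f : (Fin n → Ω) → ℝ) : ℝ :=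
  pE r (fun b => Kop k1 f b * Kop k2 f b)

/-- the potential -/
noncomputable def Wop (p : Ω → ℝ) (r : B → ℝ) (k1 k2 : B → Ω → ℝ) (M : ℝ)
    (f : (Fin n → Ω) → ℝ) : ℝ :=
  pE r (fun b => Kop k1 f b ^ 2) + pE r (fun b => Kop k2 f b ^ 2) + M * pE p f

lemma Gop_restrict (hP : KPair p r k1 k2 ρ κ) {α' : ℝ} 
    (hα : ∀ a, α' ≤ ∑ b, r b * (k1 b a * k2 b a))
    (f : (Fin n → Ω) → ℝ) (hf : ∀ x, 0 ≤ f x) (i : Fin n) (a : Ω) :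
    α' * Gop r k1 k2 (fun x => f (Function.update x i a)) ≤ Gop r k1 k2 f := by
  have hr : ∀ b, 0 ≤ r b := fun b => (hP.K1.hr b).le
  unfold Gop
  rw [← wE_smul, pE, wE_resample' (fun _ => r) i hP.K1.hr1 (fun b => Kop k1 f b * Kop k2 f b)]
  refine wE_mono _ (fun _ => hr) fun b => ?_
  simp only [Kop_update hP.K1.hk1, Kop_update hP.K2.hk1]
  have n1 : ∀ a, 0 ≤ Kop k1 (fun x => f (Function.update x i a)) b := fun a =>
    wE_nonneg _ (fun _ _ => hP.K1.hk _ _) fun x => hf _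
  have n2 : ∀ a, 0 ≤ Kop k2 (fun x => f (Function.update x i a)) b := fun a =>
    wE_nonneg _ (fun _ _ => hP.K2.hk _ _) fun x => hf _
  refine (mul_le_mul_of_nonneg_right (hα a) (mul_nonneg (n1 a) (n2 a))).trans ?_
  rw [Finset.sum_mul]
  refine Finset.sum_le_sum fun β _ => ?_
  rw [mul_assoc]
  refine mul_le_mul_of_nonneg_left ?_ (hr β)
  have q1 : k1 β a * Kop k1 (fun x => f (Function.update x i a)) b
      ≤ ∑ a, k1 β a * Kop k1 (fun x => f (Function.update x i a)) b :=
    Finset.single_le_sum (f := fun a => k1 β a * Kop k1 (fun x => f (Function.update x i a)) b)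
      (fun a _ => mul_nonneg (hP.K1.hk _ _) (n1 a)) (Finset.mem_univ a)
  have q2 : k2 β a * Kop k2 (fun x => f (Function.update x i a)) b
      ≤ ∑ a, k2 β a * Kop k2 (fun x => f (Function.update x i a)) b :=
    Finset.single_le_sum (f := fun a => k2 β a * Kop k2 (fun x => f (Function.update x i a)) b)
      (fun a _ => mul_nonneg (hP.K2.hk _ _) (n2 a)) (Finset.mem_univ a)
  have := mul_le_mul q1 q2 (mul_nonneg (hP.K2.hk _ _) (n2 a))
    ((mul_nonneg (hP.K1.hk _ _) (n1 a)).trans q1)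
  refine le_trans (le_of_eq ?_) this
  ring

lemma exists_ge_avg {α : Type} [Fintype α] {p w : α → ℝ} (hp : ∀ a, 0 ≤ p a)
    (hp1 : ∑ a, p a = 1) {t : ℝ} (h : t ≤ ∑ a, p a * w a) : ∃ a, t ≤ w a := by
  by_contra hcon
  push Not at hcon
  have hex : ∃ a, 0 < p a := by
    by_contra h0
    push Not at h0
    have : ∑ a, p a ≤ 0 := Finset.sum_nonpos fun a _ => h0 a
    linarith
  obtain ⟨a0, ha0⟩ := hex
  have : ∑ a, p a * w a < ∑ a, p a * t :=
    Finset.sum_lt_sum (fun a _ => mul_le_mul_of_nonneg_left (hcon a).le (hp a))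
      ⟨a0, Finset.mem_univ _, mul_lt_mul_of_pos_left (hcon a0) ha0⟩
  rw [← Finset.sum_mul, hp1, one_mul] at this
  linarith

lemma Wop_incr (hP : KPair p r k1 k2 ρ κ) (M τ : ℝ) (f : (Fin n → Ω) → ℝ) (i : Fin n)
    (h : τ ≤ Infl p r k1 i f ∨ τ ≤ Infl p r k2 i f) :
    ∃ a, Wop p r k1 k2 M f + (1 - ρ) * τ ≤ Wop p r k1 k2 M (fun x => f (Function.update x i a)) := by
  apply exists_ge_avg hP.K1.hp hP.K1.hp1
  have g1 := gap hP.K1 i f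
  have g2 := gap hP.K2 i f
  have g3 := wE_resample (fun _ => p) i hP.K1.hp1 f
  have i1 := Infl_nonneg hP.K1 i f
  have i2 := Infl_nonneg hP.K2 i f
  have h1 : τ ≤ Infl p r k1 i f + Infl p r k2 i f := by
    rcases h with h | h <;> linarith
  have h2 : 0 ≤ 1 - ρ := by have := hP.K1.hρ1; linarith
  have h3 := mul_le_mul_of_nonneg_left h1 h2
  unfold Wop
  simp only [mul_add, Finset.sum_add_distrib, mul_left_comm _ M, ← Finset.mul_sum]
  simp only [pE] at *
  rw [← g3]
  linarith

lemma Wop_le (hP : KPair p r k1 k2 ρ κ) {M : ℝ} (f : (Fin n → Ω) → ℝ)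
    (hf : ∀ x, f x ∈ Set.Icc (0:ℝ) 1) :
    Wop p r k1 k2 M f ≤ 2 + M * pE p f := by
  have hr : ∀ b, 0 ≤ r b := fun b => (hP.K1.hr b).le
  have b1 : pE r (fun x => Kop k1 f x ^ 2) ≤ 1 := by
    refine (wE_mono _ (fun _ => hr) (g := fun _ => 1) fun x => ?_).trans
      (wE_const _ (fun _ => hP.K1.hr1) _).le
    exact pow_le_one₀ (hP.K1.Kop_mem hf x).1 (hP.K1.Kop_mem hf x).2
  have b2 : pE r (fun x => Kop k2 f x ^ 2) ≤ 1 := by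
    refine (wE_mono _ (fun _ => hr) (g := fun _ => 1) fun x => ?_).trans
      (wE_const _ (fun _ => hP.K1.hr1) _).le
    exact pow_le_one₀ (hP.K2.Kop_mem hf x).1 (hP.K2.Kop_mem hf x).2
  unfold Wop
  linarith

lemma greedy (hP : KPair p r k1 k2 ρ κ) {α' c0 μ τ M : ℝ} (hα0 : 0 < α') (hα1 : α' ≤ 1)
    (hα : ∀ a, α' ≤ ∑ b, r b * (k1 b a * k2 b a)) (hμ : 0 < μ) (hM : M = 4 / μ) (hc0 : 0 ≤ c0)
    (hτ : 0 < τ)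
    (hlow : ∀ f : (Fin n → Ω) → ℝ, (∀ x, f x ∈ Set.Icc (0:ℝ) 1) → μ / 2 ≤ pE p f →
      (∀ i, Infl p r k1 i f ≤ τ) → (∀ i, Infl p r k2 i f ≤ τ) → c0 ≤ Gop r k1 k2 f) (K : ℕ) :
    ∀ f : (Fin n → Ω) → ℝ, (∀ x, f x ∈ Set.Icc (0:ℝ) 1) → M * μ ≤ Wop p r k1 k2 M f →
      2 + M < Wop p r k1 k2 M f + K * ((1 - ρ) * τ) → α' ^ K * c0 ≤ Gop r k1 k2 f := by
  have hM0 : 0 < M := by rw [hM]; positivity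
  have hMμ : M * μ = 4 := by rw [hM]; field_simp
  have hρ : 0 < 1 - ρ := by have := hP.K1.hρ1; linarith
  induction K with
  | zero =>
    intro f hf h1 h2
    exfalso
    have := Wop_le hP (M := M) f hf
    have h3 : pE p f ≤ 1 := (wE_mono _ (fun _ => hP.K1.hp) fun x => (hf x).2).trans
      (wE_const _ (fun _ => hP.K1.hp1) _).le
    have := mul_le_mul_of_nonneg_left h3 hM0.le
    simp at h2
    linarith
  | succ K ih =>
    intro f hf h1 h2
    by_cases hall : (∀ i, Infl p r k1 i f ≤ τ) ∧ (∀ i, Infl p r k2 i f ≤ τ)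
    · have hmean : μ / 2 ≤ pE p f := by
        have := Wop_le hP (M := M) f hf
        by_contra hcon
        push Not at hcon
        have := mul_lt_mul_of_pos_left hcon hM0
        linarith
      refine le_trans ?_ (hlow f hf hmean hall.1 hall.2)
      exact mul_le_of_le_one_left hc0 (pow_le_one₀ hα0.le hα1)
    · have : ∃ i, τ ≤ Infl p r k1 i f ∨ τ ≤ Infl p r k2 i f := by
        by_contra hcon
        push Not at hcon
        exact hall ⟨fun i => (hcon i).1.le, fun i => (hcon i).2.le⟩
      obtain ⟨i, hi⟩ := this
      obtain ⟨a, ha⟩ := Wop_incr hP M τ f i hi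
      have hθ : 0 < (1 - ρ) * τ := mul_pos hρ hτ
      have hrec := ih (fun x => f (Function.update x i a)) (fun x => hf _) (by linarith)
        (by push_cast at h2; linarith)
      have := Gop_restrict hP hα f (fun x => (hf x).1) i a
      calc _ = α' * (α' ^ K * c0) := by ring
        _ ≤ α' * Gop r k1 k2 (fun x => f (Function.update x i a)) :=
          mul_le_mul_of_nonneg_left hrec hα0.le
        _ ≤ _ := this

theorem kernel_hitting (hP : KPair p r k1 k2 ρ κ) {α' μ : ℝ} (hκ : 0 < κ) (hα0 : 0 < α')
    (hα1 : α' ≤ 1)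
    (hα : ∀ a, α' ≤ ∑ b, r b * (k1 b a * k2 b a)) (hμ : 0 < μ) :
    ∃ c : ℝ, 0 < c ∧ ∀ (n : ℕ) (f : (Fin n → Ω) → ℝ), (∀ x, f x ∈ Set.Icc (0:ℝ) 1) →
      μ ≤ pE p f → c ≤ Gop r k1 k2 f := by
  have hr := hP.K1.hr
  have hρ : 0 < 1 - ρ := by have := hP.K1.hρ1; linarith
  obtain ⟨b0⟩ : Nonempty B := by
    by_contra h
    rw [not_nonempty_iff] at h
    have := hP.K1.hr1
    simp at this
  set Bd : ℝ := ∑ b, 1 / r b with hBd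
  have hrB : ∀ b, 1 ≤ r b * Bd := fun b => by
    have : 1 / r b ≤ Bd := Finset.single_le_sum (f := fun b => 1 / r b)
      (fun b _ => (one_div_pos.2 (hr b)).le) (Finset.mem_univ b)
    rw [div_le_iff₀ (hr b)] at this
    linarith
  have hB : 1 ≤ Bd := by
    have h1 := hrB b0
    have h2 : r b0 ≤ 1 := by
      rw [← hP.K1.hr1]
      exact Finset.single_le_sum (fun b _ => (hr b).le) (Finset.mem_univ b0)
    have := hr b0
    by_contra hcon
    push Not at hcon
    nlinarith
  obtain ⟨m0, hm0⟩ := exists_nat_ge (4 / κ)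
  set m := max 4 m0 with hm
  have hm4 : 4 ≤ m := le_max_left _ _
  have hm4' : (4:ℝ) ≤ m := by exact_mod_cast hm4
  have hκm : 4 ≤ κ * m := by
    have h1 : (m0:ℝ) ≤ m := by exact_mod_cast le_max_right _ _
    have h2 := hm0.trans h1
    rw [div_le_iff₀ hκ] at h2
    linarith
  set C : ℝ := Bd * (3 * m) ^ 3 with hC
  have hC0 : 0 < C := by positivity
  have hCr : ∀ b, 1 ≤ r b * (C * (1 / (3 * m)) ^ 3) := fun b => by
    have : C * (1 / (3 * m)) ^ 3 = Bd := by rw [hC]; field_simp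
    rw [this]; exact hrB b
  set c := (1 - ρ) / (2 + Bd) with hc
  have hcpos : 0 < c := by positivity
  have hcB : c * (2 + Bd) ≤ 1 - ρ := by rw [hc]; field_simp; exact le_rfl
  have hρ0 := hP.K1.hρ0
  have hc1 : c < 1 := by nlinarith
  set γ : ℝ := 1 / (2 - c) - 1 / 2 with hγ
  have hγ0 : 0 < γ := by
    rw [hγ, sub_pos]; exact one_div_lt_one_div_of_lt (by linarith) (by linarith)
  set c0 : ℝ := ((μ / 2) ^ (2 * m) * (μ / 2) ^ (2 * m)) / 2 with hc0
  have hc0p : 0 < c0 := by positivity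
  set τ : ℝ := (c0 / (2 * C)) ^ (1 / γ) with hτ
  have hτ0 : 0 < τ := by positivity
  have hτγ : 2 * C * τ ^ γ = c0 := by
    rw [hτ, ← Real.rpow_mul (by positivity), one_div_mul_cancel hγ0.ne', Real.rpow_one]
    field_simp
  obtain ⟨K, hK⟩ := exists_nat_gt ((2 + 4 / μ) / ((1 - ρ) * τ))
  refine ⟨α' ^ K * c0, by positivity, fun n f hf hmean => ?_⟩
  refine greedy hP hα0 hα1 hα hμ rfl hc0p.le hτ0 ?_ K f hf ?_ ?_
  · intro g hg hgm hg1 hg2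
    have := low_infl hP hm4 hκm hC0.le hCr hrB hB hcpos hcB hτ0.le g hg hg1 hg2
    rw [← hγ, hτγ] at this
    have h2 : (μ / 2) ^ (2 * m) * (μ / 2) ^ (2 * m) ≤ pE p g ^ (2 * m) * pE p g ^ (2 * m) := by
      have hg0 : 0 ≤ pE p g := by linarith
      have hpow : (μ / 2) ^ (2 * m) ≤ pE p g ^ (2 * m) := pow_le_pow_left₀ (by positivity) hgm _
      exact mul_le_mul hpow hpow (by positivity) (by positivity)
    unfold Gop
    linarith
  · have n1 : 0 ≤ pE r (fun b => Kop k1 f b ^ 2) :=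
      wE_nonneg _ (fun _ b => (hr b).le) fun _ => sq_nonneg _
    have n2 : 0 ≤ pE r (fun b => Kop k2 f b ^ 2) :=
      wE_nonneg _ (fun _ b => (hr b).le) fun _ => sq_nonneg _
    have : 4 / μ * μ ≤ 4 / μ * pE p f := by gcongr
    unfold Wop
    linarith
  · have n1 : 0 ≤ pE r (fun b => Kop k1 f b ^ 2) :=
      wE_nonneg _ (fun _ b => (hr b).le) fun _ => sq_nonneg _
    have n2 : 0 ≤ pE r (fun b => Kop k2 f b ^ 2) :=
      wE_nonneg _ (fun _ b => (hr b).le) fun _ => sq_nonneg _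
    have n3 : 0 ≤ 4 / μ * pE p f := by
      have : 0 ≤ pE p f := by linarith
      positivity
    rw [div_lt_iff₀ (by positivity)] at hK
    unfold Wop
    linarith

end greedy

/-! ### The lazy cycle -/

section cycle
variable {N : ℕ} [NeZero N]

lemma cyc_shift (u : ZMod N → ℝ) : ∑ z, u (z + 1) = ∑ z, u z :=
  Equiv.sum_comp (Equiv.addRight (1 : ZMod N)) u

lemma cyc_shift' (u : ZMod N → ℝ) : ∑ z, u (z - 1) = ∑ z, u z :=
  Equiv.sum_comp (Equiv.subRight (1 : ZMod N)) u

lemma cyc_poincare (u : ZMod N → ℝ) (m : ℝ) (hm : ∑ z, u z = N * m) :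
    ∑ z, u z ^ 2 - N * m ^ 2 ≤ (N:ℝ) ^ 3 * ∑ z, (u (z + 1) - u z) ^ 2 := by
  have hN : (0:ℝ) < N := by exact_mod_cast Nat.pos_of_ne_zero (NeZero.ne N)
  set D := ∑ z, (u (z + 1) - u z) ^ 2 with hD
  have hD0 : 0 ≤ D := Finset.sum_nonneg fun z _ => sq_nonneg _
  have hd : ∀ z, |u (z + 1) - u z| ≤ √D := fun z => by
    apply Real.abs_le_sqrt
    exact Finset.single_le_sum (f := fun z => (u (z + 1) - u z) ^ 2)
      (fun z _ => sq_nonneg _) (Finset.mem_univ z)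
  have hk : ∀ (k : ℕ) z, |u (z + k) - u z| ≤ k * √D := by
    intro k
    induction k with
    | zero => intro z; simp
    | succ k ih =>
      intro z
      have h1 := ih z
      have h2 := hd (z + k)
      have e : u (z + ((k + 1 : ℕ) : ZMod N)) - u z
          = (u (z + k + 1) - u (z + k)) + (u (z + k) - u z) := by
        push_cast; rw [← add_assoc]; ring
      rw [e]
      refine (abs_add_le _ _).trans ?_
      push_cast
      linarith
  have hzw : ∀ z w, (u w - u z) ^ 2 ≤ (N:ℝ) ^ 2 * D := by
    intro z w
    have h1 := hk (w - z).val z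
    rw [ZMod.natCast_zmod_val, add_sub_cancel] at h1
    have h2 : ((w - z).val : ℝ) ≤ N := by exact_mod_cast (ZMod.val_lt _).le
    have h3 : |u w - u z| ≤ N * √D := h1.trans (by gcongr)
    rw [← sq_abs]
    calc |u w - u z| ^ 2 ≤ (N * √D) ^ 2 := pow_le_pow_left₀ (abs_nonneg _) h3 2
      _ = _ := by rw [mul_pow, Real.sq_sqrt hD0]
  have hs : ∑ z : ZMod N, ∑ w : ZMod N, (u w - u z) ^ 2 ≤ N * (N * ((N:ℝ) ^ 2 * D)) := by
    calc _ ≤ ∑ z : ZMod N, ∑ w : ZMod N, (N:ℝ) ^ 2 * D :=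
          Finset.sum_le_sum fun z _ => Finset.sum_le_sum fun w _ => hzw z w
      _ = _ := by simp [ZMod.card]
  have e : ∑ z : ZMod N, ∑ w : ZMod N, (u w - u z) ^ 2
      = 2 * N * (∑ z, u z ^ 2 - N * m ^ 2) := by
    have : ∀ z w, (u w - u z) ^ 2 = u w ^ 2 + u z ^ 2 - 2 * (u z * u w) := fun z w => by ring
    simp only [this, Finset.sum_add_distrib, Finset.sum_sub_distrib, ← Finset.mul_sum,
      ← Finset.sum_mul, hm, Finset.sum_const, Finset.card_univ, ZMod.card, nsmul_eq_mul]
    ring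
  rw [e] at hs
  have hV : (∑ z, u z ^ 2 - N * m ^ 2) * (2 * N) ≤ ((N:ℝ) ^ 3 * D) * N := by linarith
  have h3 : 0 ≤ (N:ℝ)^3 * D := by positivity
  by_contra hcon
  push Not at hcon
  nlinarith

/-- contraction factor of the lazy walk on the cycle -/
noncomputable def cycρ (N : ℕ) (q : ℝ) : ℝ := 1 - q * (1 - q) / (N:ℝ) ^ 3

lemma cycρ_nonneg {q : ℝ} (hq0 : 0 < q) (hq1 : q < 1) : 0 ≤ cycρ N q := by
  have hN : (1:ℝ) ≤ N := by exact_mod_cast Nat.one_le_iff_ne_zero.2 (NeZero.ne N)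
  unfold cycρ
  rw [sub_nonneg, div_le_one (by positivity)]
  have : (1:ℝ) ≤ (N:ℝ) ^ 3 := one_le_pow₀ hN
  nlinarith

lemma cycρ_lt {q : ℝ} (hq0 : 0 < q) (hq1 : q < 1) : cycρ N q < 1 := by
  have hN : (1:ℝ) ≤ N := by exact_mod_cast Nat.one_le_iff_ne_zero.2 (NeZero.ne N)
  unfold cycρ
  have : 0 < q * (1 - q) / (N:ℝ) ^ 3 := by
    have : 0 < 1 - q := by linarith
    positivity
  linarith

lemma cyc_contr_aux {q S D V n3 : ℝ} (hn : 0 < n3) (hq0 : 0 < q) (hq1 : q < 1)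
    (h : S - V ≤ n3 * D) :
    S - q * (1 - q) * D ≤ (1 - (1 - q * (1 - q) / n3)) * V + (1 - q * (1 - q) / n3) * S := by
  have h1 : 0 < q * (1 - q) := mul_pos hq0 (by linarith)
  have h2 : q * (1 - q) / n3 * (S - V) ≤ q * (1 - q) / n3 * (n3 * D) := by gcongr
  have h3 : q * (1 - q) / n3 * (n3 * D) = q * (1 - q) * D := by field_simp
  linarith

lemma cyc_contr {q : ℝ} (hq0 : 0 < q) (hq1 : q < 1) (u : ZMod N → ℝ) (m : ℝ)
    (hm : ∑ z, u z = N * m) :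
    ∑ z, ((1 - q) * u z + q * u (z + 1)) ^ 2
      ≤ (1 - cycρ N q) * (N * m ^ 2) + cycρ N q * ∑ z, u z ^ 2 := by
  have hN : (0:ℝ) < N := by exact_mod_cast Nat.pos_of_ne_zero (NeZero.ne N)
  have e : ∀ z, ((1 - q) * u z + q * u (z + 1)) ^ 2
      = (1 - q) * u z ^ 2 + q * u (z + 1) ^ 2 - q * (1 - q) * (u (z + 1) - u z) ^ 2 :=
    fun z => by ring
  simp only [e, Finset.sum_add_distrib, Finset.sum_sub_distrib, ← Finset.mul_sum]
  rw [cyc_shift (fun z => u z ^ 2)]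
  have := cyc_contr_aux (by positivity) hq0 hq1 (cyc_poincare u m hm)
  unfold cycρ
  linarith

lemma cyc_contr' {q : ℝ} (hq0 : 0 < q) (hq1 : q < 1) (u : ZMod N → ℝ) (m : ℝ)
    (hm : ∑ z, u z = N * m) :
    ∑ z, ((1 - q) * u z + q * u (z - 1)) ^ 2
      ≤ (1 - cycρ N q) * (N * m ^ 2) + cycρ N q * ∑ z, u z ^ 2 := by
  have hN : (0:ℝ) < N := by exact_mod_cast Nat.pos_of_ne_zero (NeZero.ne N)
  have e : ∀ z, ((1 - q) * u z + q * u (z - 1)) ^ 2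
      = (1 - q) * u z ^ 2 + q * u (z - 1) ^ 2
        - q * (1 - q) * (u z - u (z - 1)) ^ 2 :=
    fun z => by ring
  simp only [e, Finset.sum_add_distrib, Finset.sum_sub_distrib, ← Finset.mul_sum]
  rw [cyc_shift' (fun z => u z ^ 2)]
  have h2 := cyc_shift' (fun z => (u (z + 1) - u z) ^ 2)
  simp only [sub_add_cancel] at h2
  rw [h2]
  have := cyc_contr_aux (by positivity) hq0 hq1 (cyc_poincare u m hm)
  unfold cycρ
  linarith

/-- first kernel -/
noncomputable def ck1 (N : ℕ) (q : ℝ) (b : Bool × ZMod N) (x : ZMod N) : ℝ :=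
  if b.1 then (1 - q) * (if x = b.2 then 1 else 0) + q * (if x = b.2 - 1 then 1 else 0)
  else if x = b.2 then 1 else 0

/-- second kernel -/
noncomputable def ck2 (N : ℕ) (q : ℝ) (b : Bool × ZMod N) (x : ZMod N) : ℝ :=
  if b.1 then if x = b.2 then 1 else 0
  else (1 - q) * (if x = b.2 then 1 else 0) + q * (if x = b.2 + 1 then 1 else 0)

/-- the joint law -/
noncomputable def cP (N : ℕ) (q : ℝ) (x y : ZMod N) : ℝ :=
  1 / N * ((1 - q) * (if y = x then 1 else 0) + q * (if y = x + 1 then 1 else 0))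

lemma ck1_apply (q : ℝ) (b : Bool × ZMod N) (u : ZMod N → ℝ) :
    ∑ x, ck1 N q b x * u x
      = if b.1 then (1 - q) * u b.2 + q * u (b.2 - 1) else u b.2 := by
  rcases b with ⟨b, z⟩
  cases b <;> simp [ck1, add_mul, Finset.sum_add_distrib, mul_assoc, ← Finset.mul_sum]

lemma ck2_apply (q : ℝ) (b : Bool × ZMod N) (u : ZMod N → ℝ) :
    ∑ x, ck2 N q b x * u x
      = if b.1 then u b.2 else (1 - q) * u b.2 + q * u (b.2 + 1) := by
  rcases b with ⟨b, z⟩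
  cases b <;> simp [ck2, add_mul, Finset.sum_add_distrib, mul_assoc, ← Finset.mul_sum]

lemma bsum (F : Bool × ZMod N → ℝ) :
    ∑ b, F b = ∑ z, F (true, z) + ∑ z, F (false, z) := by
  rw [Fintype.sum_prod_type]; simp

lemma ck_joint (q : ℝ) (x y : ZMod N) :
    ∑ b, (1 / (2 * N) : ℝ) * (ck1 N q b x * ck2 N q b y) = cP N q x y := by
  have hN : (0:ℝ) < N := by exact_mod_cast Nat.pos_of_ne_zero (NeZero.ne N)
  rw [bsum]
  have h1 : ∀ z : ZMod N, (x = z - 1) ↔ (z = x + 1) := fun z =>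
    ⟨fun h => by rw [h]; ring, fun h => by rw [h]; ring⟩
  simp only [ck1, ck2, if_true, Bool.false_eq_true, if_false, ← Finset.mul_sum, mul_ite, mul_one,
    mul_zero, ite_mul, zero_mul, one_mul, add_mul]
  simp only [Finset.sum_ite_eq, Finset.mem_univ, if_true, h1]
  unfold cP
  simp only [mul_ite, mul_one, mul_zero]
  have h2 : (x = y) ↔ (y = x) := eq_comm
  simp only [h2]
  field_simp
  ring_nf

lemma cyc_star_aux {ρ A S T Q κ : ℝ} {N : ℕ} [NeZero N] (u w : ZMod N → ℝ) (hρ0 : 0 ≤ ρ) (hρ1 : ρ < 1)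
    (hA : A = ∑ z, (u z + w z) ^ 2) (hS : S = ∑ z, u z ^ 2) (hQ : Q = ∑ z, w z ^ 2) 
    (hw : Q ≤ ρ * T) (hT0 : 0 ≤ T) (hTS : T ≤ S) (hκ : κ = (1 - ρ) ^ 2 / 16) :
    κ * (2 * (S + T)) ≤ A := by
  have hS0 : 0 ≤ S := hT0.trans hTS
  set s := (1 + ρ) / 2 with hs
  have hs0 : 0 < s := by rw [hs]; linarith
  have h1 : 0 ≤ ∑ z, (s * u z + w z) ^ 2 := Finset.sum_nonneg fun z _ => sq_nonneg _
  have e : ∑ z, (s * u z + w z) ^ 2 = s * A - s * (1 - s) * S + (1 - s) * Q := by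
    rw [hA, hS, hQ, Finset.mul_sum, Finset.mul_sum, Finset.mul_sum, ← Finset.sum_sub_distrib,
      ← Finset.sum_add_distrib]
    exact Finset.sum_congr rfl fun z _ => by ring
  rw [e] at h1
  have h2 : (1 - s) * Q ≤ (1 - s) * (ρ * S) := by
    apply mul_le_mul_of_nonneg_left _ (by rw [hs]; linarith)
    exact hw.trans (by gcongr)
  have h3 : (1 - s) * (s - ρ) * S ≤ s * A := by nlinarith
  have h4 : (1 - s) * (s - ρ) = (1 - ρ) ^ 2 / 4 := by rw [hs]; ring
  rw [h4] at h3
  have hs1 : s ≤ 1 := by rw [hs]; linarith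
  have hA0 : 0 ≤ A := by rw [hA]; exact Finset.sum_nonneg fun z _ => sq_nonneg _
  have h5 : s * A ≤ A := mul_le_of_le_one_left hA0 hs1
  have h6 : κ * (2 * (S + T)) ≤ κ * (2 * (S + S)) := by
    rw [hκ]; gcongr
  rw [hκ] at *
  nlinarith

lemma cyc_pair {q : ℝ} (hq0 : 0 < q) (hq1 : q < 1) :
    KPair (fun _ : ZMod N => (1 / N : ℝ)) (fun _ : Bool × ZMod N => (1 / (2 * N) : ℝ))
      (ck1 N q) (ck2 N q) ((1 + cycρ N q) / 2) ((1 - cycρ N q) ^ 2 / 16) := by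
  have hN : (0:ℝ) < N := by exact_mod_cast Nat.pos_of_ne_zero (NeZero.ne N)
  have hρ0 := cycρ_nonneg (N := N) hq0 hq1
  have hρ1 := cycρ_lt (N := N) hq0 hq1
  have hq1' : 0 < 1 - q := by linarith
  have i1 : ∀ P : Prop, ∀ [Decidable P], (0:ℝ) ≤ if P then 1 else 0 := fun P _ => by
    split_ifs <;> norm_num
  have hr1 : ∑ _b : Bool × ZMod N, (1 / (2 * N) : ℝ) = 1 := by
    simp [ZMod.card]; field_simp
  have hp1 : ∑ _x : ZMod N, (1 / N : ℝ) = 1 := by simp [ZMod.card]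
  have fin : ∀ u : ZMod N → ℝ, ∑ z, u z = N * ∑ z, 1 / N * u z := fun u => by
    rw [← Finset.mul_sum]; field_simp
  refine ⟨⟨fun _ => by positivity, hr1, fun _ => by positivity, hp1, ?_, ?_, ?_, by linarith,
    by linarith, ?_⟩, ⟨fun _ => by positivity, hr1, fun _ => by positivity, hp1, ?_, ?_, ?_,
    by linarith, by linarith, ?_⟩, ?_⟩
  · rintro ⟨b, z⟩ x
    have := i1 (x = z); have := i1 (x = z - 1)
    cases b <;> simp only [ck1, if_true, Bool.false_eq_true, if_false] <;> positivity
  · intro b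
    have := ck1_apply q b (fun _ => 1)
    simp only [mul_one] at this
    rw [this]; split_ifs <;> ring
  · intro x
    have h1 : ∀ z : ZMod N, (x = z - 1) ↔ (z = x + 1) := fun z =>
      ⟨fun h => by rw [h]; ring, fun h => by rw [h]; ring⟩
    rw [bsum]
    simp only [ck1, if_true, Bool.false_eq_true, if_false, ← Finset.mul_sum,
      Finset.sum_add_distrib, h1]
    simp
    field_simp; ring
  · intro u
    rw [bsum]
    simp only [ck1_apply, if_true, Bool.false_eq_true, if_false, ← Finset.mul_sum]
    have := cyc_contr' hq0 hq1 u _ (fin u)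
    rw [← Finset.mul_sum] at this
    generalize (∑ z, ((1 - q) * u z + q * u (z - 1)) ^ 2) = A at *
    generalize (∑ z, u z ^ 2) = S at *
    generalize (∑ z, u z) = m at *
    generalize cycρ N q = ρ at *
    have h2 := mul_le_mul_of_nonneg_left this (show (0:ℝ) ≤ 1 / (2 * N) by positivity)
    refine (add_le_add_left h2 _).trans (le_of_eq ?_)
    field_simp; ring
  · rintro ⟨b, z⟩ x
    have := i1 (x = z); have := i1 (x = z + 1)
    cases b <;> simp only [ck2, if_true, Bool.false_eq_true, if_false] <;> positivity
  · intro b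
    have := ck2_apply q b (fun _ => 1)
    simp only [mul_one] at this
    rw [this]; split_ifs <;> ring
  · intro x
    have h1 : ∀ z : ZMod N, (x = z + 1) ↔ (z = x - 1) := fun z =>
      ⟨fun h => by rw [h]; ring, fun h => by rw [h]; ring⟩
    rw [bsum]
    simp only [ck2, if_true, Bool.false_eq_true, if_false, ← Finset.mul_sum,
      Finset.sum_add_distrib, h1]
    simp
    field_simp; ring
  · intro u
    rw [bsum]
    simp only [ck2_apply, if_true, Bool.false_eq_true, if_false, ← Finset.mul_sum]
    have := cyc_contr hq0 hq1 u _ (fin u)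
    rw [← Finset.mul_sum] at this
    generalize (∑ z, ((1 - q) * u z + q * u (z + 1)) ^ 2) = A at *
    generalize (∑ z, u z ^ 2) = S at *
    generalize (∑ z, u z) = m at *
    generalize cycρ N q = ρ at *
    have h2 := mul_le_mul_of_nonneg_left this (show (0:ℝ) ≤ 1 / (2 * N) by positivity)
    refine (add_le_add_right h2 _).trans (le_of_eq ?_)
    field_simp; ring
  · intro u v hu hv
    have cu := cyc_contr' hq0 hq1 u 0 (by rw [fin u, hu])
    have cv := cyc_contr hq0 hq1 v 0 (by rw [fin v, hv])
    simp only [bsum, ck1_apply, ck2_apply, if_true, Bool.false_eq_true, if_false,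
      ← Finset.mul_sum]
    generalize cycρ N q = ρ at *
    set w1 : ZMod N → ℝ := fun z => (1 - q) * u z + q * u (z - 1) with hw1
    set w2 : ZMod N → ℝ := fun z => (1 - q) * v z + q * v (z + 1) with hw2
    change ∑ z, w1 z ^ 2 ≤ _ at cu
    change ∑ z, w2 z ^ 2 ≤ _ at cv
    try simp only [← mul_add]
    change (1 - ρ) ^ 2 / 16 * (1 / (2 * N) * ((∑ z, w1 z ^ 2 + ∑ z, u z ^ 2)
      + (∑ z, v z ^ 2 + ∑ z, w2 z ^ 2)))
      ≤ 1 / (2 * N) * (∑ z, (w1 z + v z) ^ 2 + ∑ z, (u z + w2 z) ^ 2)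
    have hS0 : 0 ≤ ∑ z, u z ^ 2 := Finset.sum_nonneg fun z _ => sq_nonneg _
    have hT0 : 0 ≤ ∑ z, v z ^ 2 := Finset.sum_nonneg fun z _ => sq_nonneg _
    have hA0 : 0 ≤ ∑ z, (w1 z + v z) ^ 2 := Finset.sum_nonneg fun z _ => sq_nonneg _
    have hB0 : 0 ≤ ∑ z, (u z + w2 z) ^ 2 := Finset.sum_nonneg fun z _ => sq_nonneg _
    have key : (1 - ρ) ^ 2 / 16 * (2 * (∑ z, u z ^ 2 + ∑ z, v z ^ 2))
        ≤ ∑ z, (w1 z + v z) ^ 2 + ∑ z, (u z + w2 z) ^ 2 := by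
      rcases le_total (∑ z, v z ^ 2) (∑ z, u z ^ 2) with h | h
      · have := cyc_star_aux u w2 hρ0 hρ1 rfl rfl rfl (T := ∑ z, v z ^ 2) (by linarith) hT0 h rfl
        linarith
      · have := cyc_star_aux v w1 hρ0 hρ1 rfl rfl rfl (T := ∑ z, u z ^ 2) (by linarith) hS0 h rfl
        simp only [add_comm (v _)] at this
        linarith
    have c1 : ∑ z, w1 z ^ 2 ≤ ∑ z, u z ^ 2 := by nlinarith
    have c2 : ∑ z, w2 z ^ 2 ≤ ∑ z, v z ^ 2 := by nlinarith
    calc _ = 1 / (2 * N) * ((1 - ρ) ^ 2 / 16 * (∑ z, w1 z ^ 2 + ∑ z, u z ^ 2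
          + (∑ z, v z ^ 2 + ∑ z, w2 z ^ 2))) := by ring
      _ ≤ 1 / (2 * N) * ((1 - ρ) ^ 2 / 16 * (2 * (∑ z, u z ^ 2 + ∑ z, v z ^ 2))) := by
          gcongr; linarith
      _ ≤ 1 / (2 * N) * (∑ z, (w1 z + v z) ^ 2 + ∑ z, (u z + w2 z) ^ 2) := by gcongr

end cycle

lemma Gop_eq {Ω B : Type} [Fintype Ω] [Fintype B] (r : B → ℝ) (k1 k2 : B → Ω → ℝ) {n : ℕ}
    (f : (Fin n → Ω) → ℝ) :
    Gop r k1 k2 f = ∑ x, ∑ y, (∏ j, ∑ b, r b * (k1 b (x j) * k2 b (y j))) * (f x * f y) := by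
  unfold Gop pE Kop wE
  simp only [Finset.sum_mul_sum]
  simp only [Finset.mul_sum]
  rw [Finset.sum_comm]
  refine Finset.sum_congr rfl fun x _ => ?_
  rw [Finset.sum_comm]
  refine Finset.sum_congr rfl fun y _ => ?_
  rw [Fintype.prod_sum, Finset.sum_mul]
  refine Finset.sum_congr rfl fun b _ => ?_
  simp only [Finset.prod_mul_distrib]
  ring

theorem cycle_hitting (N : ℕ) [NeZero N] {q μ : ℝ} (hq0 : 0 < q) (hq1 : q < 1) (hμ : 0 < μ) :
    ∃ c : ℝ, 0 < c ∧ ∀ (n : ℕ) (f : (Fin n → ZMod N) → ℝ), (∀ x, f x ∈ Set.Icc (0:ℝ) 1) →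
      μ ≤ pE (fun _ => (1 / N : ℝ)) f →
      c ≤ ∑ x, ∑ y, (∏ j, cP N q (x j) (y j)) * (f x * f y) := by
  have hN : (1:ℝ) ≤ N := by exact_mod_cast Nat.one_le_iff_ne_zero.2 (NeZero.ne N)
  have hρ1 := cycρ_lt (N := N) hq0 hq1
  have hq1' : 0 < 1 - q := by linarith
  obtain ⟨c, hc, h⟩ := kernel_hitting (cyc_pair (N := N) hq0 hq1) (α' := (1 - q) / N) (μ := μ)
    (by have : 0 < 1 - cycρ N q := by linarith
        positivity) (by positivity) (by rw [div_le_one (by positivity)]; linarith)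
    (by
      intro a
      rw [ck_joint]
      simp only [cP, if_true]
      have : (0:ℝ) ≤ if a = a + 1 then 1 else 0 := by split_ifs <;> norm_num
      have h2 : 0 ≤ q * (if a = a + 1 then 1 else 0) := mul_nonneg hq0.le this
      calc (1 - q) / N = 1 / N * ((1 - q) * 1) := by ring
        _ ≤ _ := by gcongr; linarith) hμ
  refine ⟨c, hc, fun n f hf hm => ?_⟩
  have := h n f hf hm
  rw [Gop_eq] at this
  simpa only [ck_joint] using this


/-! ### Two step distributions -/

lemma pair_sum {A C : Type} [Fintype A] [Fintype C] {n : ℕ}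
    (H : (Fin n → A) → (Fin n → C) → ℝ) :
    ∑ z : Fin n → A × C, H (fun j => (z j).1) (fun j => (z j).2) = ∑ x, ∑ y, H x y := by
  rw [← Fintype.sum_prod_type' (f := H)]
  exact Fintype.sum_equiv (Equiv.arrowProdEquivProdArrow (Fin n) (fun _ => A) (fun _ => C)) _ _
    (fun z => rfl)

open Classical in
lemma push {D X : Type} [Fintype D] [Fintype X] {n : ℕ} (w : D → ℝ) (φ : D → X) (p : X → ℝ)
    (hp : ∀ x, p x = ∑ d, if φ d = x then w d else 0) (F : (Fin n → X) → ℝ) :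
    ∑ x, (∏ j, p (x j)) * F x = ∑ d : Fin n → D, (∏ j, w (d j)) * F (fun j => φ (d j)) := by
  simp only [hp]
  simp only [Fintype.prod_sum, Finset.sum_mul]
  rw [Finset.sum_comm]
  refine Finset.sum_congr rfl fun d _ => ?_
  rw [Finset.sum_eq_single (fun j => φ (d j))]
  · simp
  · intro x _ hx
    obtain ⟨j, hj⟩ := Function.ne_iff.1 hx
    rw [Finset.prod_eq_zero (Finset.mem_univ j), zero_mul]
    rw [if_neg (fun h => hj h.symm)]
  · simp

open Classical in
lemma mix_one {I Z X : Type} [Fintype I] [Fintype Z] [Fintype X] {n : ℕ} (W : I → ℝ) (Q : Z → ℝ)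
    (γ : I → Z → X) (p : X → ℝ)
    (hp : ∀ x, p x = ∑ c, ∑ t, if γ c t = x then W c * Q t else 0) (F : (Fin n → X) → ℝ) :
    pE p F = pE W (fun c => pE Q (fun s => F (fun j => γ (c j) (s j)))) := by
  have h1 := push (n := n) (fun d : I × Z => W d.1 * Q d.2) (fun d => γ d.1 d.2) p
    (fun x => by rw [hp, Fintype.sum_prod_type]) F
  have h2 := pair_sum (n := n) (fun (c : Fin n → I) (s : Fin n → Z) =>
    (∏ j, W (c j)) * ((∏ j, Q (s j)) * F (fun j => γ (c j) (s j))))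
  unfold pE wE
  rw [h1]
  simp only [Finset.mul_sum]
  rw [← h2]
  refine Finset.sum_congr rfl fun d _ => ?_
  rw [Finset.prod_mul_distrib]; ring

open Classical in
lemma mix_two {I Z X : Type} [Fintype I] [Fintype Z] [Fintype X] {n : ℕ} (W : I → ℝ)
    (Q : Z → Z → ℝ) (γ : I → Z → X) (p : X → X → ℝ)
    (hp : ∀ x y, p x y = ∑ c, ∑ t, ∑ t', if γ c t = x ∧ γ c t' = y then W c * Q t t' else 0)
    (f : (Fin n → X) → ℝ) :
    ∑ x, ∑ y, (∏ j, p (x j) (y j)) * (f x * f y)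
      = pE W (fun c : Fin n → I => ∑ s : Fin n → Z, ∑ s' : Fin n → Z, (∏ j, Q (s j) (s' j)) *
          (f (fun j => γ (c j) (s j)) * f (fun j => γ (c j) (s' j)))) := by
  have h1 := mix_one (n := n) W (fun t : Z × Z => Q t.1 t.2) (fun c t => (γ c t.1, γ c t.2))
    (fun x : X × X => p x.1 x.2) (by
      rintro ⟨x, y⟩
      simp only [hp, Fintype.sum_prod_type, Prod.mk.injEq])
    (fun z => f (fun j => (z j).1) * f (fun j => (z j).2))
  rw [← pair_sum (fun x y => (∏ j, p (x j) (y j)) * (f x * f y))]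
  refine h1.trans ?_
  congr 1
  funext c
  exact pair_sum (fun s s' : Fin n → Z => (∏ j, Q (s j) (s' j)) *
          (f (fun j => γ (c j) (s j)) * f (fun j => γ (c j) (s' j))))

lemma cP_sum (N : ℕ) [NeZero N] (q : ℝ) (x : ZMod N) (u : ZMod N → ℝ) :
    ∑ y, cP N q x y * u y = 1 / N * ((1 - q) * u x + q * u (x + 1)) := by
  have : ∀ y, cP N q x y * u y = 1 / N * (1 - q) * (if y = x then u y else 0)
      + 1 / N * q * (if y = x + 1 then u y else 0) := by
    intro y; unfold cP; split_ifs <;> ring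
  simp only [this, Finset.sum_add_distrib, ← Finset.mul_sum]
  simp; ring

lemma perm_cyc {Ω : Type} {N : ℕ} [NeZero N] (σ : Equiv.Perm Ω) (h : σ ^ N = 1) (t : ZMod N) :
    σ ^ (t + 1).val = σ * σ ^ t.val := by
  have hm : ∀ a : ℕ, σ ^ (a % N) = σ ^ a := by
    intro a
    conv_rhs => rw [← Nat.div_add_mod a N, pow_add, pow_mul, h, one_pow, one_mul]
  have : t + 1 = ((t.val + 1 : ℕ) : ZMod N) := by push_cast; simp
  rw [this, ZMod.val_natCast, hm, pow_succ']

open Classical in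
lemma perm_part {Ω : Type} [Fintype Ω] {N : ℕ} [NeZero N] (q : ℝ) (σ : Equiv.Perm Ω)
    (h : σ ^ N = 1) (v : ℝ) (x y : Ω) :
    ∑ x0, ∑ t : ZMod N, ∑ t' : ZMod N, (if (σ ^ t.val) x0 = x ∧ (σ ^ t'.val) x0 = y then
      (if σ x0 ≠ x0 then v else 0) * cP N q t t' else 0)
      = (if σ x ≠ x then v else 0) *
        ((1 - q) * (if x = y then 1 else 0) + q * (if σ x = y then 1 else 0)) := by
  have hN : (N:ℝ) ≠ 0 := by exact_mod_cast NeZero.ne N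
  have h1 : ∀ x0, ∀ t : ZMod N, ∑ t' : ZMod N,
      (if (σ ^ t.val) x0 = x ∧ (σ ^ t'.val) x0 = y then
      (if σ x0 ≠ x0 then v else 0) * cP N q t t' else 0)
      = if (σ ^ t.val) x0 = x then 1 / N * ((if σ x ≠ x then v else 0) *
        ((1 - q) * (if x = y then 1 else 0) + q * (if σ x = y then 1 else 0))) else 0 := by
    intro x0 t
    by_cases hx : (σ ^ t.val) x0 = x
    · have h2 : (σ x0 = x0) ↔ (σ x = x) := by
        rw [← hx, ← Equiv.Perm.mul_apply, ← pow_succ', pow_succ, Equiv.Perm.mul_apply]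
        exact ((σ ^ t.val).injective.eq_iff).symm
      have h3 := cP_sum N q t (fun t' => if (σ ^ t'.val) x0 = y then
        (if σ x0 ≠ x0 then v else 0) else 0)
      have h4 : (σ ^ (t+1).val) x0 = σ x := by
        rw [perm_cyc σ h, Equiv.Perm.mul_apply, hx]
      simp only [hx, h4] at h3
      simp only [hx, true_and, if_true]
      have h2' : (if σ x ≠ x then v else 0) = (if σ x0 ≠ x0 then v else 0) := by simp only [ne_eq, h2]
      rw [h2']
      calc _ = _ := Finset.sum_congr rfl fun t' _ => by
            rw [show (if (σ ^ t'.val) x0 = y then (if σ x0 ≠ x0 then v else 0) * cP N q t t' else 0)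
              = cP N q t t' * (if (σ ^ t'.val) x0 = y then (if σ x0 ≠ x0 then v else 0) else 0) by
                split_ifs <;> ring]
        _ = _ := h3
        _ = _ := by split_ifs <;> ring
    · simp [hx]
  simp only [h1]
  rw [Finset.sum_comm]
  have h5 : ∀ (t : ZMod N) (K : ℝ), (∑ x0, if (σ ^ t.val) x0 = x then K else 0) = K := by
    intro t K
    rw [Finset.sum_eq_single ((σ ^ t.val).symm x)]
    · simp
    · intro b _ hb
      rw [if_neg]
      intro h
      exact hb (by rw [← h]; simp)
    · simp
  simp only [h5]
  rw [Finset.sum_const, Finset.card_univ, ZMod.card, nsmul_eq_mul]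
  field_simp

theorem two_step (α μ : ℝ) (hα : 0 < α) (hα1 : α ≤ 1) (hμ : 0 < μ) :
    ∃ c : ℝ, 0 < c ∧ ∀ (Ω : Type) [Fintype Ω] (P2 : Ω → Ω → ℝ) (π : Ω → ℝ),
      (∀ x y, 0 ≤ P2 x y) → (∀ x, ∑ y, P2 x y = π x) → (∀ y, ∑ x, P2 x y = π y) →
      ∑ x, π x = 1 → (∀ x, α ≤ P2 x x) →
      ∀ (n : ℕ) (f : (Fin n → Ω) → ℝ), (∀ x, f x ∈ Set.Icc (0:ℝ) 1) → μ ≤ pE π f →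
        c ≤ ∑ x, ∑ y, (∏ j, P2 (x j) (y j)) * (f x * f y) := by
  classical
  set q : ℝ := 1 / (1 + α) with hq
  have hq0 : 0 < q := by positivity
  have hq1 : q < 1 := by rw [hq, div_lt_one (by positivity)]; linarith
  have hqα : (1 - q) / q = α := by rw [hq]; field_simp; ring
  set N : ℕ := (⌊1 / α⌋₊).factorial with hNdef
  haveI : NeZero N := ⟨Nat.factorial_ne_zero _⟩
  have hN : (N:ℝ) ≠ 0 := by exact_mod_cast NeZero.ne N
  obtain ⟨c0, hc0, hc⟩ := cycle_hitting N (q := q) (μ := μ / 2) hq0 hq1 (by positivity)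
  refine ⟨c0 * (μ / 2), by positivity, ?_⟩
  intro Ω _ P2 π hP hrow hcol hsum hdiag n f hf hfm
  have hle : ∀ x y, P2 x y ≤ π x := fun x y => by
    rw [← hrow x]; exact Finset.single_le_sum (fun z _ => hP x z) (Finset.mem_univ y)
  have hπ0 : ∀ x, 0 ≤ π x := fun x => (hP x x).trans (hle x x)
  have hπ1 : ∀ x, π x ≤ 1 := fun x => by
    rw [← hsum]; exact Finset.single_le_sum (fun z _ => hπ0 z) (Finset.mem_univ x)
  have hcard : Fintype.card Ω ≤ ⌊1 / α⌋₊ := by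
    apply Nat.le_floor
    rw [le_div_iff₀ hα]
    calc (Fintype.card Ω : ℝ) * α = ∑ x : Ω, α := by simp
      _ ≤ ∑ x, π x := Finset.sum_le_sum fun x _ => (hdiag x).trans (hle x x)
      _ = 1 := hsum
  have hσN : ∀ σ : Equiv.Perm Ω, σ ^ N = 1 := by
    intro σ
    rw [← orderOf_dvd_iff_pow_eq_one]
    refine (orderOf_dvd_card (x := σ)).trans ?_
    rw [Fintype.card_perm]
    exact Nat.factorial_dvd_factorial hcard
  -- Birkhoff
  have hM : (Matrix.of fun x y => P2 x y + if x = y then 1 - π x else 0) ∈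
      doublyStochastic ℝ Ω := by
    rw [mem_doublyStochastic_iff_sum]
    refine ⟨?_, ?_, ?_⟩
    · intro x y
      have := hπ1 x
      have := hP x y
      simp only [Matrix.of_apply]
      split_ifs <;> linarith
    · intro x; simp [Finset.sum_add_distrib, hrow]
    · intro x; simp [Finset.sum_add_distrib, hcol]
  obtain ⟨w, hw0, hw1, hw⟩ := exists_eq_sum_perm_of_mem_doublyStochastic hM
  have hwxy : ∀ x y, ∑ σ, w σ * (if σ x = y then 1 else 0)
      = P2 x y + if x = y then 1 - π x else 0 := by
    intro x y
    have := congrFun (congrFun hw x) y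
    simp only [Matrix.sum_apply, Matrix.smul_apply, smul_eq_mul, Matrix.of_apply,
      Equiv.Perm.permMatrix, PEquiv.toMatrix_apply, Equiv.toPEquiv_apply, Option.mem_some_iff] at this
    rw [← this]
  set W : (Equiv.Perm Ω × Ω) ⊕ Ω → ℝ := Sum.elim
    (fun p => if p.1 p.2 ≠ p.2 then w p.1 / q else 0)
    (fun x => P2 x x - α * (π x - P2 x x)) with hW
  set γ : (Equiv.Perm Ω × Ω) ⊕ Ω → ZMod N → Ω := Sum.elim
    (fun p t => (p.1 ^ t.val) p.2) (fun x _ => x) with hγ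
  have hW0 : ∀ c, 0 ≤ W c := by
    rintro (⟨σ, x⟩ | x)
    · simp only [hW, Sum.elim_inl]
      have := hw0 σ
      split_ifs <;> positivity
    · simp only [hW, Sum.elim_inr]
      have h1 := hdiag x
      have h2 := hπ1 x
      have h3 := hle x x
      nlinarith
  have hcPsum : ∀ t, ∑ t', cP N q t t' = 1 / N := by
    intro t
    have := cP_sum N q t (fun _ => 1)
    simp only [mul_one] at this
    rw [this]; ring
  have hmix : ∀ x y, P2 x y = ∑ c, ∑ t, ∑ t',
      if γ c t = x ∧ γ c t' = y then W c * cP N q t t' else 0 := by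
    intro x y
    rw [Fintype.sum_sum_type, Fintype.sum_prod_type]
    simp only [hW, hγ, Sum.elim_inl, Sum.elim_inr]
    have h1 := fun σ : Equiv.Perm Ω => perm_part q σ (hσN σ) (w σ / q) x y
    simp only [h1]
    have h2 : ∀ z, (∑ t : ZMod N, ∑ t' : ZMod N, if z = x ∧ z = y then
        (P2 z z - α * (π z - P2 z z)) * cP N q t t' else 0) =
        if z = x then (if x = y then (P2 x x - α * (π x - P2 x x)) else 0) else 0 := by
      intro z
      by_cases hz : z = x
      · subst hz
        by_cases hy : z = y
        · simp only [hy, and_self, if_true, ← Finset.mul_sum, hcPsum]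
          simp [hN]
        · simp [hy]
      · simp [hz]
    simp only [h2]
    simp only [Finset.sum_ite_eq', Finset.mem_univ, if_true]
    have h3 : ∑ σ, w σ * (if σ x = x then (1:ℝ) else 0) = P2 x x + (1 - π x) := by
      rw [hwxy]; simp
    by_cases hxy : x = y
    · subst hxy
      simp only [if_true]
      have h4 : ∀ σ : Equiv.Perm Ω, (if σ x ≠ x then w σ / q else 0) *
          ((1 - q) * 1 + q * (if σ x = x then 1 else 0))
          = α * (w σ - w σ * (if σ x = x then 1 else 0)) := by
        intro σ
        rw [← hqα]
        by_cases hs : σ x = x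
        · simp [hs]
        · simp [hs]; ring
      simp only [h4]
      rw [← Finset.mul_sum, Finset.sum_sub_distrib, hw1, h3]
      ring
    · simp only [hxy, if_false]
      have h4 : ∀ σ : Equiv.Perm Ω, (if σ x ≠ x then w σ / q else 0) *
          ((1 - q) * 0 + q * (if σ x = y then 1 else 0))
          = w σ * (if σ x = y then 1 else 0) := by
        intro σ
        by_cases hs : σ x = y
        · have : σ x ≠ x := by rw [hs]; exact fun h => hxy h.symm
          simp only [hs] at this ⊢
          simp only [this, ne_eq, not_false_eq_true, if_true]
          field_simp
          ring
        · simp [hs]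
      simp only [h4]
      rw [hwxy]; simp [hxy]
  have hmix1 : ∀ x, π x = ∑ c, ∑ t : ZMod N, if γ c t = x then W c * (1 / N : ℝ) else 0 := by
    intro x
    rw [← hrow x]
    simp only [hmix]
    rw [Finset.sum_comm]
    refine Finset.sum_congr rfl fun c _ => ?_
    rw [Finset.sum_comm]
    refine Finset.sum_congr rfl fun t _ => ?_
    rw [Finset.sum_comm]
    by_cases ht : γ c t = x
    · simp [ht, ← Finset.mul_sum, hcPsum]
    · simp [ht]
  have hW1 : ∑ c, W c = 1 := by
    rw [← hsum]
    simp only [hmix1]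
    rw [Finset.sum_comm]
    refine Finset.sum_congr rfl fun c _ => ?_
    rw [Finset.sum_comm]
    simp
    field_simp
  rw [mix_two W (cP N q) γ P2 hmix f]
  rw [mix_one W (fun _ : ZMod N => (1 / N : ℝ)) γ π hmix1 f] at hfm
  set h := fun c : Fin n → (Equiv.Perm Ω × Ω) ⊕ Ω => pE (fun _ : ZMod N => (1 / N : ℝ))
    (fun s => f (fun j => γ (c j) (s j)))
  have hstep : pE W (fun c => c0 * (h c - μ / 2)) ≤ pE W (fun c => ∑ s : Fin n → ZMod N, ∑ s' : Fin n → ZMod N,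
      (∏ j, cP N q (s j) (s' j)) * (f (fun j => γ (c j) (s j)) * f (fun j => γ (c j) (s' j)))) := by
    refine wE_mono _ (fun _ a => hW0 a) fun c => ?_
    have hh1 : h c ≤ 1 := by
      calc h c ≤ pE (fun _ : ZMod N => (1 / N : ℝ)) (fun _ : Fin n → ZMod N => (1:ℝ)) :=
            wE_mono _ (fun _ _ => by positivity) fun s => (hf _).2
        _ = 1 := wE_const _ (fun _ => by simp [hN]) 1
    by_cases hc2 : μ / 2 ≤ h c
    · have := hc n (fun s => f (fun j => γ (c j) (s j))) (fun s => hf _) hc2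
      refine le_trans ?_ this
      nlinarith
    · have h1 : c0 * (h c - μ / 2) ≤ 0 := by
        push Not at hc2
        nlinarith
      refine h1.trans (Finset.sum_nonneg fun s _ => Finset.sum_nonneg fun s' _ => ?_)
      refine mul_nonneg (Finset.prod_nonneg fun j _ => ?_) (mul_nonneg (hf _).1 (hf _).1)
      unfold cP
      have h5 : 0 ≤ 1 - q := by linarith
      have := hq0.le
      split_ifs <;> positivity
  refine le_trans ?_ hstep
  unfold pE at hfm ⊢
  rw [wE_smul, wE_sub, wE_const _ (fun _ => hW1)]
  have : μ ≤ wE (fun _ => W) h := hfm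
  nlinarith


/-! ### Chains of several steps -/

section chain
variable {V : Type} [Fintype V]

/-- Expected product along a chain, started at a given vertex. -/
noncomputable def Val (f : V → ℝ) : (m : ℕ) → (Fin m → V → V → ℝ) → V → ℝ
  | 0, _, v => f v
  | (m + 1), T, v => f v * ∑ w, T 0 v w * Val f m (fun j => T j.succ) w

lemma Val_nonneg {f : V → ℝ} (hf : ∀ v, 0 ≤ f v) : ∀ (m : ℕ) (T : Fin m → V → V → ℝ),
    (∀ j v w, 0 ≤ T j v w) → ∀ v, 0 ≤ Val f m T v
  | 0, _, _, v => hf v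
  | (m + 1), T, hT, v => mul_nonneg (hf v) (Finset.sum_nonneg fun w _ =>
      mul_nonneg (hT 0 v w) (Val_nonneg hf m _ (fun j => hT j.succ) w))

lemma Val_sum (f : V → ℝ) : ∀ (m : ℕ) (T : Fin m → V → V → ℝ) (a : V → ℝ),
    ∑ x : Fin (m + 1) → V, (a (x 0) * ∏ j : Fin m, T j (x j.castSucc) (x j.succ)) * ∏ j, f (x j)
      = ∑ v, a v * Val f m T v
  | 0, T, a => by
      simp only [Val]
      refine Fintype.sum_equiv (Equiv.funUnique (Fin 1) V) _ _ fun x => ?_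
      simp [Equiv.funUnique]
  | (m + 1), T, a => by
      rw [← (Fin.consEquiv (fun _ : Fin (m + 1 + 1) => V)).sum_comp, Fintype.sum_prod_type]
      refine Finset.sum_congr rfl fun v _ => ?_
      simp only [Val]
      rw [← Val_sum f m (fun j => T j.succ) (fun w => T 0 v w), Finset.mul_sum, Finset.mul_sum]
      refine Finset.sum_congr rfl fun y _ => ?_
      simp only [Fin.consEquiv, Equiv.coe_fn_mk]
      rw [Fin.prod_univ_succ (n := m), Fin.prod_univ_succ (n := m + 1)]
      simp only [Fin.cons_zero, Fin.cons_succ, Fin.castSucc_zero, ← Fin.succ_castSucc]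
      ring

end chain

theorem chain (c2 : ℝ → ℝ) (hc2 : ∀ μ, 0 < c2 μ) : ∀ (m : ℕ) (μ : ℝ), 0 < μ →
    ∃ ν c : ℝ, 0 < ν ∧ 0 < c ∧ ∀ (V : Type) [Fintype V] (p : V → ℝ) (T : Fin m → V → V → ℝ),
      (∀ v, 0 ≤ p v) → ∑ v, p v = 1 → (∀ j v w, 0 ≤ T j v w) →
      (∀ j, ∀ h : V → ℝ, (∀ v, h v ∈ Set.Icc (0:ℝ) 1) → ∀ μ', 0 < μ' → μ' ≤ ∑ v, p v * h v →
        c2 μ' ≤ ∑ v, p v * (h v * ∑ w, T j v w * h w)) →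
      ∀ f : V → ℝ, (∀ v, f v ∈ Set.Icc (0:ℝ) 1) → μ ≤ ∑ v, p v * f v →
      ∃ g : V → ℝ, (∀ v, 0 ≤ g v ∧ g v ≤ f v) ∧ ν ≤ ∑ v, p v * g v ∧
        ∀ v, c * g v ≤ Val f m T v
  | 0, μ, hμ => ⟨μ, 1, hμ, one_pos, fun V _ p T _ _ _ _ f hf hm =>
      ⟨f, fun v => ⟨(hf v).1, le_rfl⟩, hm, fun v => by simp [Val]⟩⟩
  | (m + 1), μ, hμ => by
      obtain ⟨ν, c, hν, hc, ih⟩ := chain c2 hc2 m μ hμ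
      have hη : 0 < c2 (ν / 2) / 2 := half_pos (hc2 _)
      set η := c2 (ν / 2) / 2 with hηdef
      refine ⟨ν / 2, c * η, half_pos hν, mul_pos hc hη, ?_⟩
      intro V _ p T hp hp1 hT h2 f hf hm
      obtain ⟨g, hg, hgν, hgV⟩ := ih V p (fun j => T j.succ) hp hp1 (fun j => hT j.succ)
        (fun j => h2 j.succ) f hf hm
      have hg1 : ∀ v, g v ≤ 1 := fun v => (hg v).2.trans (hf v).2
      set h : V → ℝ := fun v => if ∑ w, T 0 v w * g w < η then g v else 0 with hh
      have hh0 : ∀ v, 0 ≤ h v := fun v => by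
        simp only [hh]; split_ifs; exacts [(hg v).1, le_rfl]
      have hhg : ∀ v, h v ≤ g v := fun v => by
        simp only [hh]; split_ifs; exacts [le_rfl, (hg v).1]
      have hsmall : ∑ v, p v * h v < ν / 2 := by
        by_contra hcon
        push Not at hcon
        have h3 := h2 0 h (fun v => ⟨hh0 v, (hhg v).trans (hg1 v)⟩) (ν / 2) (half_pos hν) hcon
        have h4 : ∑ v, p v * (h v * ∑ w, T 0 v w * h w) ≤ ∑ v, p v * η := by
          refine Finset.sum_le_sum fun v _ => mul_le_mul_of_nonneg_left ?_ (hp v)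
          by_cases hv : ∑ w, T 0 v w * g w < η
          · have h5 : ∑ w, T 0 v w * h w ≤ ∑ w, T 0 v w * g w :=
              Finset.sum_le_sum fun w _ => mul_le_mul_of_nonneg_left (hhg w) (hT 0 v w)
            have h6 : 0 ≤ ∑ w, T 0 v w * h w :=
              Finset.sum_nonneg fun w _ => mul_nonneg (hT 0 v w) (hh0 w)
            have h7 : h v ≤ 1 := (hhg v).trans (hg1 v)
            have := hh0 v
            nlinarith
          · have : h v = 0 := by simp only [hh]; rw [if_neg hv]
            rw [this, zero_mul]; exact hη.le
        rw [← Finset.sum_mul, hp1, one_mul] at h4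
        have := hc2 (ν / 2)
        linarith
      refine ⟨fun v => g v - h v, fun v => ⟨by linarith [hhg v], by linarith [hh0 v, (hg v).2]⟩,
        ?_, fun v => ?_⟩
      · simp only [mul_sub, Finset.sum_sub_distrib]
        linarith
      · by_cases hv : ∑ w, T 0 v w * g w < η
        · have : h v = g v := by simp only [hh]; rw [if_pos hv]
          simp only [this, sub_self, mul_zero]
          exact Val_nonneg (fun v => (hf v).1) _ _ hT v
        · have : h v = 0 := by simp only [hh]; rw [if_neg hv]
          simp only [this, sub_zero, Val]
          push Not at hv
          have h5 : c * ∑ w, T 0 v w * g w ≤ ∑ w, T 0 v w * Val f m (fun j => T j.succ) w := by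
            rw [Finset.mul_sum]
            refine Finset.sum_le_sum fun w _ => ?_
            have := mul_le_mul_of_nonneg_left (hgV w) (hT 0 v w)
            linarith
          have h6 : c * η ≤ ∑ w, T 0 v w * Val f m (fun j => T j.succ) w :=
            (mul_le_mul_of_nonneg_left hv hc.le).trans h5
          calc c * η * g v ≤ c * η * f v :=
                mul_le_mul_of_nonneg_left (hg v).2 (mul_pos hc hη).le
            _ = f v * (c * η) := mul_comm _ _
            _ ≤ _ := mul_le_mul_of_nonneg_left h6 (hf v).1

section markov
variable {Ω : Type} [Fintype Ω] {m : ℕ}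

lemma pr_congr' {ℓ : ℕ} (P : (Fin ℓ → Ω) → ℝ) {E F : (Fin ℓ → Ω) → Prop} (h : ∀ y, E y ↔ F y) :
    pr P E = pr P F := by
  have : E = F := funext fun y => propext (h y)
  rw [this]

lemma pr_nonneg' {ℓ : ℕ} {P : (Fin ℓ → Ω) → ℝ} (hP : ∀ x, 0 ≤ P x) (E : (Fin ℓ → Ω) → Prop) :
    0 ≤ pr P E :=
  Finset.sum_nonneg fun y _ => by split_ifs; exacts [hP y, le_rfl]

lemma pr_mono' {ℓ : ℕ} {P : (Fin ℓ → Ω) → ℝ} (hP : ∀ x, 0 ≤ P x) {E F : (Fin ℓ → Ω) → Prop}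
    (h : ∀ y, E y → F y) : pr P E ≤ pr P F := by
  refine Finset.sum_le_sum fun y _ => ?_
  by_cases hE : E y
  · simp [hE, h y hE]
  · rw [if_neg hE]; split_ifs; exacts [hP y, le_rfl]

lemma pr_single {ℓ : ℕ} (P : (Fin ℓ → Ω) → ℝ) (x : Fin ℓ → Ω) : pr P (fun y => y = x) = P x := by
  classical
  unfold pr
  rw [Finset.sum_eq_single x]
  · simp
  · intro b _ hb; simp [hb]
  · simp

/-- Joint law of two consecutive steps. -/
noncomputable def jl (P : (Fin (m + 1) → Ω) → ℝ) (j : Fin m) (a b : Ω) : ℝ :=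
  pr P (fun y => y j.castSucc = a ∧ y j.succ = b)

lemma jl_row (P : (Fin (m + 1) → Ω) → ℝ) {π : Ω → ℝ} (hπ : HasMarginals P π) (j : Fin m) (a : Ω) :
    ∑ b, jl P j a b = π a := by
  classical
  rw [← hπ j.castSucc a]
  unfold jl pr marginal
  rw [Finset.sum_comm]
  refine Finset.sum_congr rfl fun y _ => ?_
  by_cases h : y j.castSucc = a <;> simp [h]

lemma jl_col (P : (Fin (m + 1) → Ω) → ℝ) {π : Ω → ℝ} (hπ : HasMarginals P π) (j : Fin m) (b : Ω) :
    ∑ a, jl P j a b = π b := by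
  classical
  rw [← hπ j.succ b]
  unfold jl pr marginal
  rw [Finset.sum_comm]
  refine Finset.sum_congr rfl fun y _ => ?_
  by_cases h : y j.succ = b <;> simp [h]

lemma markov_formula {P : (Fin (m + 1) → Ω) → ℝ} {π : Ω → ℝ} (hP : ∀ x, 0 ≤ P x)
    (hπ : HasMarginals P π) (hM : MarkovGenerated P) (x : Fin (m + 1) → Ω) :
    P x = π (x 0) * ∏ j : Fin m, (jl P j (x j.castSucc) (x j.succ) / π (x j.castSucc)) := by
  classical
  set r : ℕ → ℝ := fun k => if h : k < m then
    jl P ⟨k, h⟩ (x (Fin.castSucc ⟨k, h⟩)) (x (Fin.succ ⟨k, h⟩)) / π (x (Fin.castSucc ⟨k, h⟩)) else 1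
    with hr
  have hmarg : ∀ j a, pr P (fun y => y j = a) = π a := by
    intro j a; rw [← hπ j a]; unfold pr marginal
    exact Finset.sum_congr rfl fun y _ => by congr
  have key : ∀ k, k ≤ m → pr P (fun y => ∀ i : Fin (m + 1), (i : ℕ) ≤ k → y i = x i)
      = π (x 0) * ∏ i ∈ Finset.range k, r i := by
    intro k
    induction k with
    | zero =>
      intro _
      rw [Finset.prod_range_zero, mul_one, ← hmarg 0 (x 0)]
      refine pr_congr' P fun y => ⟨fun h => h 0 le_rfl, fun h i hi => ?_⟩
      have : i = 0 := Fin.ext (by simpa using hi)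
      rw [this, h]
    | succ k ih =>
      intro hk
      have hk' : k < m := hk
      rw [Finset.prod_range_succ, ← mul_assoc, ← ih hk'.le]
      set j : Fin m := ⟨k, hk'⟩ with hj
      have hMj := hM j.succ (by simp) x
      have e1 : pr P (fun y => ∀ i : Fin (m + 1), (i : ℕ) < (j.succ : ℕ) → y i = x i)
          = pr P (fun y => ∀ i : Fin (m + 1), (i : ℕ) ≤ k → y i = x i) :=
        pr_congr' P fun y => by simp [hj, Nat.lt_succ_iff]
      have ev : ∀ y : Fin (m + 1) → Ω, (∀ i : Fin (m + 1), (i : ℕ) + 1 = (j.succ : ℕ) → y i = x i) ↔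
          y j.castSucc = x j.castSucc := by
        intro y
        refine ⟨fun h => h _ (by simp), fun h i hi => ?_⟩
        have : i = j.castSucc := Fin.ext (by simpa using hi)
        rw [this, h]
      have e2 : pr P (fun y => ∀ i : Fin (m + 1), (i : ℕ) + 1 = (j.succ : ℕ) → y i = x i)
          = π (x j.castSucc) := by
        rw [← hmarg]; exact pr_congr' P ev
      have e3 : pr P (fun y => y j.succ = x j.succ ∧
          ∀ i : Fin (m + 1), (i : ℕ) + 1 = (j.succ : ℕ) → y i = x i)
          = jl P j (x j.castSucc) (x j.succ) :=
        pr_congr' P fun y => by rw [ev y, and_comm]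
      have e4 : pr P (fun y => ∀ i : Fin (m + 1), (i : ℕ) ≤ (j.succ : ℕ) → y i = x i)
          = pr P (fun y => ∀ i : Fin (m + 1), (i : ℕ) ≤ k + 1 → y i = x i) :=
        pr_congr' P fun y => by simp [hj]
      rw [e1, e2, e3, e4] at hMj
      have hrk : r k = jl P j (x j.castSucc) (x j.succ) / π (x j.castSucc) := by
        simp only [hr, dif_pos hk', hj]
      rw [hrk]
      have h0 := pr_nonneg' hP (fun y => ∀ i : Fin (m + 1), (i : ℕ) ≤ k → y i = x i)
      rcases h0.lt_or_eq with hpos | hz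
      · rw [← hMj hpos]
        field_simp
      · rw [← hz, zero_mul]
        refine le_antisymm ?_ (pr_nonneg' hP _)
        rw [hz]
        exact pr_mono' hP fun y h i hi => h i (by omega)
  have h1 := key m le_rfl
  have h2 : pr P (fun y => ∀ i : Fin (m + 1), (i : ℕ) ≤ m → y i = x i) = P x := by
    rw [← pr_single P x]
    refine pr_congr' P fun y => ⟨fun h => funext fun i => h i (by omega), fun h i _ => by rw [h]⟩
  rw [← h2, h1, Finset.prod_range]
  congr 1
  refine Finset.prod_congr rfl fun j _ => ?_
  simp only [hr, dif_pos j.2]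

end markov


theorem markov_same_set_hitting :
    ∀ ℓ : ℕ, 2 ≤ ℓ →
    ∀ α μ : ℝ, α ∈ Set.Ioc (0:ℝ) 1 → μ ∈ Set.Ioc (0:ℝ) 1 →
    ∃ δ : ℝ, 0 < δ ∧
      ∀ (Ω : Type) [Fintype Ω],
      ∀ (P : (Fin ℓ → Ω) → ℝ) (π : Ω → ℝ),
        IsDist P → HasMarginals P π → (∀ a : Ω, 0 < π a) →
        MarkovGenerated P →
        (∀ x : Ω, α ≤ P (fun _ => x)) →
        ∀ n : ℕ, 1 ≤ n →
        ∀ f : (Fin n → Ω) → ℝ, (∀ v, f v ∈ Set.Icc (0:ℝ) 1) →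
          exps π f = μ →
          δ ≤ prodExp P (fun _ => f) := by
  intro ℓ hℓ α μ hα hμ
  obtain ⟨m, rfl⟩ : ∃ m, ℓ = m + 1 := ⟨ℓ - 1, by omega⟩
  have hex : ∀ μ' : ℝ, ∃ c : ℝ, 0 < c ∧ (0 < μ' →
      ∀ (Ω : Type) [Fintype Ω] (P2 : Ω → Ω → ℝ) (π : Ω → ℝ),
      (∀ x y, 0 ≤ P2 x y) → (∀ x, ∑ y, P2 x y = π x) → (∀ y, ∑ x, P2 x y = π y) →
      ∑ x, π x = 1 → (∀ x, α ≤ P2 x x) →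
      ∀ (n : ℕ) (f : (Fin n → Ω) → ℝ), (∀ x, f x ∈ Set.Icc (0:ℝ) 1) → μ' ≤ pE π f →
        c ≤ ∑ x, ∑ y, (∏ j, P2 (x j) (y j)) * (f x * f y)) := by
    intro μ'
    by_cases h : 0 < μ'
    · obtain ⟨c, hc, h1⟩ := two_step α μ' hα.1 hα.2 h
      exact ⟨c, hc, fun _ => h1⟩
    · exact ⟨1, one_pos, fun h' => absurd h' h⟩
  choose c2 hc2 htwo using hex
  obtain ⟨ν, c, hν, hc, hchain⟩ := chain c2 hc2 m μ hμ.1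
  refine ⟨c * ν, mul_pos hc hν, ?_⟩
  intro Ω _ P π hP hmarg hπ hM hdiag n _ f hf hfm
  have hπ1 : ∑ a, π a = 1 := by
    classical
    rw [← hP.2]
    simp only [← hmarg 0, marginal]
    rw [Finset.sum_comm]
    simp
  set p : (Fin n → Ω) → ℝ := fun v => ∏ i, π (v i) with hp
  set T : Fin m → (Fin n → Ω) → (Fin n → Ω) → ℝ :=
    fun j v w => ∏ i, (jl P j (v i) (w i) / π (v i)) with hT
  have hjl0 : ∀ j a b, 0 ≤ jl P j a b := fun j a b => pr_nonneg' hP.1 _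
  have hp0 : ∀ v, 0 ≤ p v := fun v => Finset.prod_nonneg fun i _ => (hπ _).le
  have hp1 : ∑ v, p v = 1 := by
    have := wE_const (n := n) (fun _ => π) (fun _ => hπ1) 1
    simpa [wE, hp] using this
  obtain ⟨g, hg, hgν, hgV⟩ := hchain (Fin n → Ω) p T hp0 hp1
    (fun j v w => Finset.prod_nonneg fun i _ => div_nonneg (hjl0 _ _ _) (hπ _).le)
    (by
      intro j h hh μ' hμ' hle
      have h1 := htwo μ' hμ' Ω (jl P j) π (hjl0 j) (jl_row P hmarg j) (jl_col P hmarg j) hπ1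
        (by
          intro x
          refine (hdiag x).trans ?_
          rw [← pr_single P]
          exact pr_mono' hP.1 fun y hy => by simp [hy]) n h hh hle
      refine h1.trans (le_of_eq ?_)
      refine Finset.sum_congr rfl fun v _ => ?_
      rw [Finset.mul_sum, Finset.mul_sum]
      refine Finset.sum_congr rfl fun w _ => ?_
      have : ∏ i, jl P j (v i) (w i) = p v * T j v w := by
        simp only [hp, hT, ← Finset.prod_mul_distrib]
        refine Finset.prod_congr rfl fun i _ => ?_
        have := (hπ (v i)).ne'
        field_simp
      rw [this]; ring)
    f hf hfm.ge
  have hval : prodExp P (fun _ => f) = ∑ v, p v * Val f m T v := by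
    rw [← Val_sum f m T p]
    unfold prodExp
    refine Finset.sum_congr rfl fun x _ => ?_
    congr 1
    simp only [hp, hT]
    rw [Finset.prod_comm, ← Finset.prod_mul_distrib]
    exact Finset.prod_congr rfl fun i _ => markov_formula hP.1 hmarg hM _
  rw [hval]
  calc c * ν ≤ c * ∑ v, p v * g v := mul_le_mul_of_nonneg_left hgν hc.le
    _ = ∑ v, p v * (c * g v) := by
      rw [Finset.mul_sum]; exact Finset.sum_congr rfl fun v _ => by ring
    _ ≤ _ := Finset.sum_le_sum fun v _ => mul_le_mul_of_nonneg_left (hgV v) (hp0 v)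

end SameSetHitting
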